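/- arXiv:1407.2108 — 11 statements merged into one kernel-verified Lean document; each statement's English description precedes it below -/
import Mathlib

section
/- Let f be an n-variate homogeneous cubic polynomial (f ∈ H_{n,3}) and let r, m be integers with 1 ≤ r ≤ m and m ≥ 3. Then f_{Δ(n,r)} − f_{Δ(n,m)} ≤ ((m−r)(4mr−2m−2r)/(r²(m−1)(m−2))) · (\overline{f} − \underline{f}). -/
open Finset

/-- The regular grid Δ(n,r): points of the standard simplex whose coordinates are
rationals with denominator r. -/
noncomputable def gridSet (n r : ℕ) : Set (Fin n → ℝ) :=
  {x ∈ stdSimplex ℝ (Fin n) | ∀ i, ∃ k : ℕ, (r : ℝ) * x i = (k : ℝ)}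

/-- `f_{Δ(n,r)}` : the minimum of `f` over the regular grid `Δ(n,r)`. -/
noncomputable def gridMin (n r : ℕ) (f : (Fin n → ℝ) → ℝ) : ℝ := sInf (f '' gridSet n r)

/-- `\underline{f}` : the minimum of `f` over the standard simplex. -/
noncomputable def simplexMin (n : ℕ) (f : (Fin n → ℝ) → ℝ) : ℝ :=
  sInf (f '' stdSimplex ℝ (Fin n))

/-- `\overline{f}` : the maximum of `f` over the standard simplex. -/
noncomputable def simplexMax (n : ℕ) (f : (Fin n → ℝ) → ℝ) : ℝ :=
  sSup (f '' stdSimplex ℝ (Fin n))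

section DownwardAverage

variable {ι : Type*} [Fintype ι] [DecidableEq ι]

/-- `φ` is an eigenfunction, of degree `k`, of the operators that average over the removal of
one ball drawn from an urn with `α i` balls of colour `i`. -/
def IsRemovalEigen (k : ℕ) (φ : (ι → ℕ) → ℝ) : Prop :=
  ∀ α : ι → ℕ, ∑ l, (α l : ℝ) * φ (α - Pi.single l 1) = ((∑ i, α i : ℕ) - (k : ℝ)) * φ α

lemma sum_sub_single_one {α : ι → ℕ} {l : ι} (hl : α l ≠ 0) :
    ∑ i, (α - Pi.single l 1 : ι → ℕ) i + 1 = ∑ i, α i := by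
  have h : α = (α - Pi.single l 1 : ι → ℕ) + Pi.single l 1 := by
    ext i
    by_cases hi : i = l
    · subst hi; simp; omega
    · simp [hi]
  conv_rhs => rw [h]
  simp [Finset.sum_add_distrib]

lemma IsRemovalEigen.eq_zero {k : ℕ} {φ : (ι → ℕ) → ℝ} (hφ : IsRemovalEigen k φ) (s : ℕ) :
    s < k → ∀ α : ι → ℕ, ∑ i, α i = s → φ α = 0 := by
  induction s using Nat.strong_induction_on with
  | _ s ih =>
    intro hs α hα
    have h := hφ α
    rw [Finset.sum_eq_zero, hα] at h
    · have hne : (s : ℝ) - k ≠ 0 := by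
        have : (s : ℝ) < k := by exact_mod_cast hs
        linarith
      exact (mul_eq_zero.mp h.symm).resolve_left hne
    · intro l _
      by_cases hl : α l = 0
      · simp [hl]
      · have h1 := sum_sub_single_one hl
        rw [ih (s - 1) (by omega) (by omega) _ (by omega), mul_zero]

/-- Sampling `r` balls without replacement from an urn with `m` balls, for sums of
eigenfunctions of degrees three, two and one. -/
lemma le_of_isRemovalEigen {φ ψ χ : (ι → ℕ) → ℝ} (hφ : IsRemovalEigen 3 φ)
    (hψ : IsRemovalEigen 2 ψ) (hχ : IsRemovalEigen 1 χ) {r : ℕ} (hr : 1 ≤ r) {q : ℝ}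
    (hq : ∀ β : ι → ℕ, ∑ i, β i = r → q ≤ φ β + ψ β + χ β) (m : ℕ) (hrm : r ≤ m) :
    ∀ α : ι → ℕ, ∑ i, α i = m →
      q ≤ (r : ℝ) * (r - 1) * (r - 2) / (m * (m - 1) * (m - 2)) * φ α +
        (r : ℝ) * (r - 1) / (m * (m - 1)) * ψ α + (r : ℝ) / m * χ α := by
  induction m, hrm using Nat.le_induction with
  | base =>
    intro α hα
    have h := hq α hα
    have hr0 : (r : ℝ) ≠ 0 := by positivity
    rcases (by omega : r = 1 ∨ r = 2 ∨ 3 ≤ r) with h1 | h1 | h1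
    · have := hφ.eq_zero r (by omega) α hα
      have := hψ.eq_zero r (by omega) α hα
      subst h1
      simp_all
    · have := hφ.eq_zero r (by omega) α hα
      subst h1
      simp_all
      norm_num
      linarith
    · have h3 : (3 : ℝ) ≤ r := by exact_mod_cast h1
      have e1 : (r : ℝ) - 1 ≠ 0 := by linarith
      have e2 : (r : ℝ) - 2 ≠ 0 := by linarith
      rw [div_self (by positivity), div_self (by positivity), div_self hr0]
      linarith
  | succ m hrm ih =>
    intro α hα
    set a : ℝ := (r : ℝ) * (r - 1) * (r - 2) / (m * (m - 1) * (m - 2)) with ha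
    set b : ℝ := (r : ℝ) * (r - 1) / (m * (m - 1)) with hb
    set c : ℝ := (r : ℝ) / m with hc
    have hstep : ∀ l, (α l : ℝ) * q ≤ α l * (a * φ (α - Pi.single l 1) +
        b * ψ (α - Pi.single l 1) + c * χ (α - Pi.single l 1)) := by
      intro l
      by_cases hl : α l = 0
      · simp [hl]
      · have h1 := sum_sub_single_one hl
        exact mul_le_mul_of_nonneg_left (ih _ (by omega)) (by positivity)
    have hsum := Finset.sum_le_sum fun l (_ : l ∈ Finset.univ) => hstep l
    have e1 := hφ α
    have e2 := hψ α
    have e3 := hχ α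
    rw [hα] at e1 e2 e3
    have hR : ∑ l, (α l : ℝ) * (a * φ (α - Pi.single l 1) +
        b * ψ (α - Pi.single l 1) + c * χ (α - Pi.single l 1)) =
        a * ∑ l, (α l : ℝ) * φ (α - Pi.single l 1) +
        b * ∑ l, (α l : ℝ) * ψ (α - Pi.single l 1) +
        c * ∑ l, (α l : ℝ) * χ (α - Pi.single l 1) := by
      simp only [Finset.mul_sum, ← Finset.sum_add_distrib]
      exact Finset.sum_congr rfl fun l _ => by ring
    have hL : ∑ l, (α l : ℝ) * q = ((m + 1 : ℕ) : ℝ) * q := by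
      rw [← Finset.sum_mul, ← hα]; push_cast; rfl
    rw [hL, hR, e1, e2, e3] at hsum
    have hm1 : (0 : ℝ) < ((m + 1 : ℕ) : ℝ) := by positivity
    refine le_of_mul_le_mul_left (hsum.trans (le_of_eq ?_)) hm1
    have hm0 : (m : ℝ) ≠ 0 := by
      have : m ≠ 0 := by omega
      exact_mod_cast this
    have hm1' : (m : ℝ) + 1 ≠ 0 := by positivity
    rw [ha, hb, hc]
    push_cast
    rcases (by omega : r = 1 ∨ r = 2 ∨ 3 ≤ r) with h1 | h1 | h1
    · subst h1
      norm_num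
      field_simp
    · subst h1
      have h2 : (2 : ℝ) ≤ m := by exact_mod_cast hrm
      have e1 : (m : ℝ) - 1 ≠ 0 := by linarith
      norm_num
      field_simp
      ring
    · have h3 : (3 : ℝ) ≤ m := by exact_mod_cast h1.trans hrm
      have e1 : (m : ℝ) - 1 ≠ 0 := by linarith
      have e2 : (m : ℝ) - 2 ≠ 0 := by linarith
      have e3 : (m : ℝ) + 1 - 1 ≠ 0 := by linarith
      have e4 : (m : ℝ) + 1 - 2 ≠ 0 := by linarith
      field_simp
      ring

lemma IsRemovalEigen.sum {κ : Type*} {s : Finset κ} {k : ℕ} {c : κ → ℝ}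
    {φ : κ → (ι → ℕ) → ℝ} (h : ∀ j ∈ s, IsRemovalEigen k (φ j)) :
    IsRemovalEigen k fun α => ∑ j ∈ s, c j * φ j α := by
  intro α
  simp only [Finset.mul_sum]
  rw [Finset.sum_comm]
  refine Finset.sum_congr rfl fun j hj => ?_
  have := h j hj α
  calc _ = c j * ∑ l, (α l : ℝ) * φ j (α - Pi.single l 1) := by
        rw [Finset.mul_sum]; exact Finset.sum_congr rfl fun l _ => by ring
    _ = _ := by rw [this]; ring

lemma isRemovalEigen_of_real {k : ℕ} {g : (ι → ℝ) → ℝ}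
    (hg : ∀ x : ι → ℝ, ∑ l, x l * g (fun i => x i - if i = l then 1 else 0) =
      ((∑ i, x i) - (k : ℝ)) * g x) :
    IsRemovalEigen k fun α => g fun i => (α i : ℝ) := by
  intro α
  have h := hg fun i => (α i : ℝ)
  push_cast
  rw [← h]
  refine Finset.sum_congr rfl fun l _ => ?_
  by_cases hl : α l = 0
  · simp [hl]
  · congr 2
    ext i
    by_cases hi : i = l
    · subst hi
      simp [Nat.cast_sub (Nat.one_le_iff_ne_zero.mpr hl)]
    · simp [hi]

lemma isRemovalEigen_coord (i : ι) : IsRemovalEigen 1 fun α : ι → ℕ => (α i : ℝ) := by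
  refine isRemovalEigen_of_real (g := fun x => x i) fun x => ?_
  simp [mul_sub, Finset.sum_sub_distrib, ← Finset.sum_mul]
  ring

lemma isRemovalEigen_pair (i j : ι) :
    IsRemovalEigen 2 fun α : ι → ℕ => (α i : ℝ) * (α j - if i = j then 1 else 0) := by
  refine isRemovalEigen_of_real
    (g := fun x => x i * (x j - if i = j then 1 else 0)) fun x => ?_
  have h : ∀ l, x l * ((x i - if i = l then 1 else 0) *
      ((x j - if j = l then 1 else 0) - if i = j then 1 else 0)) =
      x l * (x i * (x j - if i = j then 1 else 0)) -
      (if j = l then x l * x i else 0) -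
      (if i = l then x l * ((x j - if j = i then 1 else 0) - if i = j then 1 else 0) else 0) := by
    intro l
    by_cases h1 : i = l
    · subst h1; by_cases h2 : j = i <;> simp [h2] <;> ring
    · by_cases h2 : j = l
      · subst h2; simp [h1]; ring
      · simp [h1, h2]
  rw [Finset.sum_congr rfl fun l _ => h l]
  simp only [Finset.sum_sub_distrib, ← Finset.sum_mul, Finset.sum_ite_eq, Finset.mem_univ, if_true]
  by_cases h2 : i = j
  · subst h2; simp; ring
  · simp [h2, Ne.symm h2]; ring

lemma isRemovalEigen_triple (i j k : ι) :
    IsRemovalEigen 3 fun α : ι → ℕ => (α i : ℝ) * (α j - if i = j then 1 else 0) *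
      (α k - (if i = k then 1 else 0) - if j = k then 1 else 0) := by
  refine isRemovalEigen_of_real
    (g := fun x => x i * (x j - if i = j then 1 else 0) *
      (x k - (if i = k then 1 else 0) - if j = k then 1 else 0)) fun x => ?_
  by_cases h1 : i = j
  · subst h1
    by_cases h2 : i = k
    · subst h2
      have h : ∀ l, x l * ((x i - if i = l then 1 else 0) *
          ((x i - if i = l then 1 else 0) - 1) * ((x i - if i = l then 1 else 0) - 1 - 1)) =
          x l * (x i * (x i - 1) * (x i - 1 - 1)) +
          if i = l then x l * (-3 * (x i - 1) * (x i - 2)) else 0 := by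
        intro l; split_ifs <;> ring
      simp only [if_true, h]
      simp only [Finset.sum_add_distrib, ← Finset.sum_mul, Finset.sum_ite_eq, Finset.mem_univ,
        if_true]
      push_cast; ring
    · have h : ∀ l, x l * ((x i - if i = l then 1 else 0) *
          ((x i - if i = l then 1 else 0) - 1) * ((x k - if k = l then 1 else 0) - 0 - 0)) =
          x l * (x i * (x i - 1) * x k) +
          (if i = l then x l * (-2 * (x i - 1) * x k) else 0) +
          (if k = l then x l * (- x i * (x i - 1)) else 0) := by
        intro l
        by_cases h3 : i = l
        · have : k ≠ l := fun h => h2 (h3.trans h.symm)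
          simp only [h3, this, if_true, if_false]; ring
        · simp only [h3, if_false]; split_ifs <;> ring
      simp only [if_true, h2, if_false, h]
      simp only [Finset.sum_add_distrib, ← Finset.sum_mul, Finset.sum_ite_eq, Finset.mem_univ,
        if_true]
      push_cast; ring
  · by_cases h2 : i = k
    · subst h2
      have h : ∀ l, x l * ((x i - if i = l then 1 else 0) *
          ((x j - if j = l then 1 else 0) - 0) * ((x i - if i = l then 1 else 0) - 1 - 0)) =
          x l * (x i * (x i - 1) * x j) +
          (if i = l then x l * (-2 * (x i - 1) * x j) else 0) +
          (if j = l then x l * (- x i * (x i - 1)) else 0) := by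
        intro l
        by_cases h3 : i = l
        · have : j ≠ l := fun h => h1 (h3.trans h.symm)
          simp only [h3, this, if_true, if_false]; ring
        · simp only [h3, if_false]; split_ifs <;> ring
      simp only [if_true, h1, Ne.symm h1, if_false, h]
      simp only [Finset.sum_add_distrib, ← Finset.sum_mul, Finset.sum_ite_eq, Finset.mem_univ,
        if_true]
      push_cast; ring
    · by_cases h3 : j = k
      · subst h3
        have h : ∀ l, x l * ((x i - if i = l then 1 else 0) *
            ((x j - if j = l then 1 else 0) - 0) * ((x j - if j = l then 1 else 0) - 0 - 1)) =
            x l * (x j * (x j - 1) * x i) +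
            (if j = l then x l * (-2 * (x j - 1) * x i) else 0) +
            (if i = l then x l * (- x j * (x j - 1)) else 0) := by
          intro l
          by_cases h3 : i = l
          · have : j ≠ l := fun h => h1 (h3.trans h.symm)
            simp only [h3, this, if_true, if_false]; ring
          · simp only [h3, if_false]; split_ifs <;> ring
        simp only [if_true, h1, if_false, h]
        simp only [Finset.sum_add_distrib, ← Finset.sum_mul, Finset.sum_ite_eq, Finset.mem_univ,
          if_true]
        push_cast; ring
      · have h : ∀ l, x l * ((x i - if i = l then 1 else 0) *
            ((x j - if j = l then 1 else 0) - 0) * ((x k - if k = l then 1 else 0) - 0 - 0)) =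
            x l * (x i * x j * x k) -
            (if i = l then x l * (x j * x k) else 0) -
            (if j = l then x l * (x i * x k) else 0) -
            (if k = l then x l * (x i * x j) else 0) := by
          intro l
          by_cases e1 : i = l
          · have f1 : j ≠ l := fun h => h1 (e1.trans h.symm)
            have f2 : k ≠ l := fun h => h2 (e1.trans h.symm)
            simp only [e1, f1, f2, if_true, if_false]; ring
          · by_cases e2 : j = l
            · have f2 : k ≠ l := fun h => h3 (e2.trans h.symm)
              simp only [e1, e2, f2, if_true, if_false]; ring
            · simp only [e1, e2, if_false]; split_ifs <;> ring
        simp only [h1, h2, h3, if_false, h]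
        simp only [Finset.sum_sub_distrib, ← Finset.sum_mul, Finset.sum_ite_eq, Finset.mem_univ,
          if_true]
        push_cast; ring

end DownwardAverage

section CubicForm

variable {ι : Type*} [Fintype ι]

/-- The cubic form with coefficient array `T`. -/
def cubicForm (T : ι → ι → ι → ℝ) (x : ι → ℝ) : ℝ :=
  ∑ i, ∑ j, ∑ k, T i j k * (x i * x j * x k)

lemma cubicForm_smul (T : ι → ι → ι → ℝ) (c : ℝ) (x : ι → ℝ) :
    cubicForm T (fun i => c * x i) = c ^ 3 * cubicForm T x := by
  simp only [cubicForm, Finset.mul_sum]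
  refine Finset.sum_congr rfl fun i _ => Finset.sum_congr rfl fun j _ =>
    Finset.sum_congr rfl fun k _ => by ring

lemma cubicForm_sub_const (T : ι → ι → ι → ℝ) (c : ℝ) (x : ι → ℝ) :
    cubicForm (fun i j k => T i j k - c) x = cubicForm T x - c * (∑ i, x i) ^ 3 := by
  have h : c * (∑ i, x i) ^ 3 = ∑ i, ∑ j, ∑ k, c * (x i * x j * x k) := by
    simp only [pow_succ, pow_zero, one_mul, ← Finset.mul_sum, ← Finset.sum_mul]
  simp only [cubicForm, h, ← Finset.sum_sub_distrib, sub_mul]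

variable [DecidableEq ι]

lemma cubicForm_single (T : ι → ι → ι → ℝ) (i : ι) :
    cubicForm T (Pi.single i 1) = T i i i := by
  simp [cubicForm, Pi.single_apply]

lemma cubicForm_single_add_single (T : ι → ι → ι → ℝ) (i j : ι) :
    cubicForm T (Pi.single i 1 + Pi.single j 1) =
      T i i i + T j j j + (T i i j + T i j i + T j i i) + (T j j i + T j i j + T i j j) := by
  simp [cubicForm, Pi.single_apply, mul_add, Finset.sum_add_distrib]
  ring

lemma cubicForm_eq_falling_parts (T : ι → ι → ι → ℝ) (x : ι → ℝ) :
    cubicForm T x =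
      (∑ i, ∑ j, ∑ k, T i j k * (x i * (x j - if i = j then 1 else 0) *
        (x k - (if i = k then 1 else 0) - if j = k then 1 else 0))) +
      (∑ i, ∑ j, (T i i j + T i j i + T j i i) * (x i * (x j - if i = j then 1 else 0))) +
      ∑ i, T i i i * x i := by
  have h : ∀ i j k, T i j k * (x i * (x j - if i = j then 1 else 0) *
        (x k - (if i = k then 1 else 0) - if j = k then 1 else 0)) =
      T i j k * (x i * x j * x k) - (if i = j then T i j k * (x i * x k) else 0) -
      (if i = k then T i j k * (x i * x j) else 0) - (if j = k then T i j k * (x i * x j) else 0) +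
      (if i = j then (if i = k then 2 * T i i i * x i else 0) else 0) := by
    intro i j k
    by_cases h1 : i = j
    · subst h1
      by_cases h2 : i = k
      · subst h2; simp; ring
      · simp [h2]; ring
    · by_cases h2 : i = k
      · subst h2; simp [h1, Ne.symm h1]; ring
      · by_cases h3 : j = k
        · subst h3; simp [h1]; ring
        · simp [h1, h2, h3]
  have h2 : ∀ i j, (T i i j + T i j i + T j i i) * (x i * (x j - if i = j then 1 else 0)) =
      T i i j * (x i * x j) + T i j i * (x i * x j) + T j i i * (x j * x i) -
        if i = j then 3 * T i i i * x i else 0 := by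
    intro i j
    by_cases h1 : i = j
    · subst h1; simp; ring
    · simp [h1]; ring
  simp only [h, h2, Finset.sum_add_distrib, Finset.sum_sub_distrib, Finset.sum_ite_eq,
    Finset.mem_univ, if_true, cubicForm]
  have e1 : ∑ i, ∑ j, ∑ k, (if i = j then T i j k * (x i * x k) else 0) =
      ∑ i, ∑ k, T i i k * (x i * x k) := by
    refine Finset.sum_congr rfl fun i _ => ?_
    rw [Finset.sum_comm]
    simp
  have e3 : ∑ i, ∑ j, ∑ k, (if i = j then (if i = k then 2 * T i i i * x i else 0) else 0) =
      ∑ i, 2 * T i i i * x i := by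
    refine Finset.sum_congr rfl fun i _ => ?_
    rw [Finset.sum_comm]
    simp
  have e4 : ∑ i, ∑ j, T j i i * (x j * x i) = ∑ i, ∑ j, T i j j * (x i * x j) :=
    Finset.sum_comm
  rw [e1, e3, e4]
  have e5 : ∑ i, 3 * T i i i * x i = 3 * ∑ i, T i i i * x i := by
    rw [Finset.mul_sum]; exact Finset.sum_congr rfl fun i _ => by ring
  have e6 : ∑ i, 2 * T i i i * x i = 2 * ∑ i, T i i i * x i := by
    rw [Finset.mul_sum]; exact Finset.sum_congr rfl fun i _ => by ring
  rw [e5, e6]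
  ring

lemma sum_pair_part_le (T : ι → ι → ι → ℝ) (D : ℝ)
    (hD : ∀ i j, cubicForm T (Pi.single i 1 + Pi.single j 1) ≤ 8 * D)
    (x : ι → ℝ) (hx : ∀ i, 0 ≤ x i) :
    ∑ i, ∑ j, (T i i j + T i j i + T j i i) * (x i * (x j - if i = j then 1 else 0)) ≤
      4 * D * (∑ i, x i) ^ 2 - ((∑ i, x i) + 3) * ∑ i, T i i i * x i := by
  set A : ι → ι → ℝ := fun i j => T i i j + T i j i + T j i i with hA
  have h1 : ∑ i, ∑ j, A i j * (x i * (x j - if i = j then 1 else 0)) =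
      ∑ i, ∑ j, A i j * (x i * x j) - 3 * ∑ i, T i i i * x i := by
    rw [Finset.mul_sum, ← Finset.sum_sub_distrib]
    refine Finset.sum_congr rfl fun i _ => ?_
    have : ∀ j, A i j * (x i * (x j - if i = j then 1 else 0)) =
        A i j * (x i * x j) - if i = j then A i j * x i else 0 := by
      intro j; split_ifs <;> ring
    rw [Finset.sum_congr rfl fun j _ => this j, Finset.sum_sub_distrib, Finset.sum_ite_eq,
      if_pos (Finset.mem_univ i)]
    simp only [hA]
    ring
  have h2 : 2 * ∑ i, ∑ j, A i j * (x i * x j) = ∑ i, ∑ j, (A i j + A j i) * (x i * x j) := by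
    have : ∑ i, ∑ j, A i j * (x i * x j) = ∑ i, ∑ j, A j i * (x i * x j) := by
      rw [Finset.sum_comm]
      exact Finset.sum_congr rfl fun i _ => Finset.sum_congr rfl fun j _ => by ring
    simp only [add_mul, Finset.sum_add_distrib]
    linarith
  have h3 : ∑ i, ∑ j, (A i j + A j i) * (x i * x j) ≤
      ∑ i, ∑ j, (8 * D - T i i i - T j j j) * (x i * x j) := by
    refine Finset.sum_le_sum fun i _ => Finset.sum_le_sum fun j _ =>
      mul_le_mul_of_nonneg_right ?_ (mul_nonneg (hx i) (hx j))
    have := hD i j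
    rw [cubicForm_single_add_single] at this
    simp only [hA]
    linarith
  have h4 : ∑ i, ∑ j, (8 * D - T i i i - T j j j) * (x i * x j) =
      8 * D * (∑ i, x i) ^ 2 - 2 * ((∑ i, x i) * ∑ i, T i i i * x i) := by
    have e1 : (∑ i, x i) ^ 2 = ∑ i, ∑ j, x i * x j := by rw [sq, Finset.sum_mul_sum]
    have e2 : (∑ i, x i) * ∑ i, T i i i * x i = ∑ i, ∑ j, x i * (T j j j * x j) :=
      Finset.sum_mul_sum ..
    have e3 : (∑ i, x i) * ∑ i, T i i i * x i = ∑ i, ∑ j, T i i i * x i * x j := by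
      rw [mul_comm, Finset.sum_mul_sum]
    rw [two_mul, e1]
    nth_rewrite 1 [e2]
    rw [e3]
    simp only [Finset.mul_sum, ← Finset.sum_sub_distrib, ← Finset.sum_add_distrib]
    exact Finset.sum_congr rfl fun i _ => Finset.sum_congr rfl fun j _ => by ring
  rw [h1]
  linarith

/-- The comparison between grids for a cubic form with values in `[0, D]` on the simplex. -/
lemma sub_le_of_cubicForm (T : ι → ι → ι → ℝ) (D : ℝ)
    (hT0 : ∀ i, 0 ≤ T i i i) (hTD : ∀ i, T i i i ≤ D)
    (hD : ∀ i j, cubicForm T (Pi.single i 1 + Pi.single j 1) ≤ 8 * D)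
    {r m : ℕ} (hr : 1 ≤ r) (hrm : r ≤ m) (hm : 3 ≤ m) {q : ℝ}
    (hq : ∀ β : ι → ℕ, ∑ i, β i = r → (r : ℝ) ^ 3 * q ≤ cubicForm T fun i => (β i : ℝ))
    (α : ι → ℕ) (hα : ∑ i, α i = m) {v : ℝ} (hv0 : 0 ≤ v)
    (hv : (m : ℝ) ^ 3 * v = cubicForm T fun i => (α i : ℝ)) :
    q - v ≤ ((m : ℝ) - r) * (4 * m * r - 2 * m - 2 * r) /
          ((r : ℝ) ^ 2 * ((m : ℝ) - 1) * ((m : ℝ) - 2)) * D := by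
  have hφ : IsRemovalEigen 3 fun α : ι → ℕ => ∑ i, 1 * ∑ j, 1 * ∑ k, T i j k *
      ((α i : ℝ) * (α j - if i = j then 1 else 0) *
        (α k - (if i = k then 1 else 0) - if j = k then 1 else 0)) :=
    .sum fun i _ => .sum fun j _ => .sum fun k _ => isRemovalEigen_triple i j k
  have hψ : IsRemovalEigen 2 fun α : ι → ℕ => ∑ i, 1 * ∑ j, (T i i j + T i j i + T j i i) *
      ((α i : ℝ) * (α j - if i = j then 1 else 0)) :=
    .sum fun i _ => .sum fun j _ => isRemovalEigen_pair i j
  have hχ : IsRemovalEigen 1 fun α : ι → ℕ => ∑ i, T i i i * (α i : ℝ) :=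
    .sum fun i _ => isRemovalEigen_coord i
  simp only [one_mul] at hφ hψ
  have key := le_of_isRemovalEigen hφ hψ hχ hr (q := (r : ℝ) ^ 3 * q)
    (fun β hβ => (hq β hβ).trans_eq (cubicForm_eq_falling_parts T fun i => (β i : ℝ))) m hrm α hα
  have hsplit := hv.trans (cubicForm_eq_falling_parts T fun i => (α i : ℝ))
  have hpair := sum_pair_part_le T D hD (fun i => (α i : ℝ)) fun i => by positivity
  have hαR : ∑ i, (α i : ℝ) = m := by exact_mod_cast hα
  have hχ0 : 0 ≤ ∑ i, T i i i * (α i : ℝ) :=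
    Finset.sum_nonneg fun i _ => mul_nonneg (hT0 i) (by positivity)
  have hχD : ∑ i, T i i i * (α i : ℝ) ≤ D * m := by
    rw [← hαR, Finset.mul_sum]
    exact Finset.sum_le_sum fun i _ => mul_le_mul_of_nonneg_right (hTD i) (by positivity)
  beta_reduce at key hsplit hpair
  rw [hαR] at hpair
  generalize (∑ i, ∑ j, ∑ k, T i j k * ((α i : ℝ) * (α j - if i = j then 1 else 0) *
        (α k - (if i = k then 1 else 0) - if j = k then 1 else 0))) = φ at key hsplit
  generalize (∑ i, ∑ j, (T i i j + T i j i + T j i i) *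
      ((α i : ℝ) * (α j - if i = j then 1 else 0))) = ψ at key hsplit hpair
  generalize ∑ i, T i i i * (α i : ℝ) = χ at *
  have hr1 : (1 : ℝ) ≤ r := by exact_mod_cast hr
  have hrmR : (r : ℝ) ≤ m := by exact_mod_cast hrm
  have hm3 : (3 : ℝ) ≤ m := by exact_mod_cast hm
  clear hφ hψ hχ hq hD hT0 hTD hv hαR
  generalize (r : ℝ) = r at *
  generalize (m : ℝ) = m at *
  have p1 : 0 < m - 1 := by linarith
  have p2 : 0 < m - 2 := by linarith
  have pm : 0 < m := by linarith
  have pr : 0 < r := by linarith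
  have hmD : 0 ≤ D := by
    by_contra! h
    nlinarith
  have key2 : r ^ 2 * m * (m - 1) * (m - 2) * q ≤
      (r - 1) * (r - 2) * φ + (r - 1) * (m - 2) * ψ + (m - 1) * (m - 2) * χ := by
    have e : r * (r - 1) * (r - 2) / (m * (m - 1) * (m - 2)) * φ +
        r * (r - 1) / (m * (m - 1)) * ψ + r / m * χ =
        r * ((r - 1) * (r - 2) * φ + (r - 1) * (m - 2) * ψ + (m - 1) * (m - 2) * χ) /
          (m * (m - 1) * (m - 2)) := by
      field_simp
    rw [e, le_div_iff₀ (by positivity)] at key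
    refine le_of_mul_le_mul_left ?_ pr
    linarith
  have hφ : φ = m ^ 3 * v - ψ - χ := by linarith
  have key3 : r ^ 2 * m * (m - 1) * (m - 2) * (q - v) ≤
      (m - r) * (-(3 * m * r - 2 * m - 2 * r) * (m * v) + (r - 1) * ψ + (m + r - 3) * χ) := by
    rw [hφ] at key2
    linarith
  have hv' : 0 ≤ (3 * m * r - 2 * m - 2 * r) * (m * v) := by
    refine mul_nonneg ?_ (by positivity)
    nlinarith
  have hψ' := mul_le_mul_of_nonneg_left hpair (by linarith : 0 ≤ r - 1)
  have hfin : (r - 1) * ψ + (m + r - 3) * χ ≤ D * m * (4 * m * r - 2 * m - 2 * r) := by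
    have h1 : (2 * m - r * m - 2 * r) * χ ≤ D * m * (2 * m - 2 * r) := by
      have : (2 * m - 2 * r) * χ ≤ (2 * m - 2 * r) * (D * m) :=
        mul_le_mul_of_nonneg_left hχD (by linarith)
      have : 0 ≤ r * m * χ := by positivity
      linarith
    linarith
  have key4 : r ^ 2 * m * (m - 1) * (m - 2) * (q - v) ≤
      (m - r) * (D * m * (4 * m * r - 2 * m - 2 * r)) :=
    key3.trans (mul_le_mul_of_nonneg_left (by linarith) (by linarith))
  rw [div_mul_eq_mul_div, le_div_iff₀ (by positivity)]
  refine le_of_mul_le_mul_left ?_ pm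
  linarith

lemma MvPolynomial.IsHomogeneous.exists_eval_eq_cubicForm {p : MvPolynomial ι ℝ}
    (hp : p.IsHomogeneous 3) :
    ∃ T : ι → ι → ι → ℝ, ∀ x, MvPolynomial.eval x p = cubicForm T x := by
  have hmono : ∀ d ∈ p.support, ∃ T : ι → ι → ι → ℝ, ∀ x : ι → ℝ,
      p.coeff d * ∏ i, x i ^ d i = cubicForm T x := by
    intro d hd
    have hdeg : d.degree = 3 := by
      rw [Finsupp.degree_eq_weight_one (R := ℕ)]
      exact hp (MvPolynomial.mem_support_iff.mp hd)
    have hcard : (Finsupp.toMultiset d).card = 3 := by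
      rw [Finsupp.card_toMultiset, ← hdeg]; rfl
    obtain ⟨a, b, c, habc⟩ := Multiset.card_eq_three.mp hcard
    refine ⟨fun i j k => if a = i then if b = j then if c = k then p.coeff d else 0 else 0 else 0,
      fun x => ?_⟩
    have hprod : ∏ i, x i ^ d i = x a * x b * x c := by
      have h := congrArg (fun s => (s.map x).prod) habc
      simp only [Finsupp.toMultiset_map, Finsupp.prod_toMultiset] at h
      rw [Finsupp.prod_mapDomain_index (by simp) (by intros; rw [pow_add]),
        Finsupp.prod_fintype _ _ (by simp)] at h
      simpa [mul_assoc] using h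
    rw [hprod]
    simp [cubicForm]
  choose! T hT using hmono
  refine ⟨fun i j k => ∑ d ∈ p.support, T d i j k, fun x => ?_⟩
  rw [MvPolynomial.eval_eq', Finset.sum_congr rfl fun d hd => hT d hd x]
  simp only [cubicForm, Finset.sum_mul]
  rw [Finset.sum_comm]
  refine Finset.sum_congr rfl fun i _ => ?_
  rw [Finset.sum_comm]
  refine Finset.sum_congr rfl fun j _ => ?_
  rw [Finset.sum_comm]

end CubicForm

lemma div_mem_gridSet {n r : ℕ} (hr : 1 ≤ r) {β : Fin n → ℕ} (hβ : ∑ i, β i = r) :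
    (fun i => (r : ℝ)⁻¹ * β i) ∈ gridSet n r := by
  have hr0 : (r : ℝ) ≠ 0 := by positivity
  refine ⟨⟨fun i => by positivity, ?_⟩, fun i => ⟨β i, by field_simp⟩⟩
  rw [← Finset.mul_sum, ← Nat.cast_sum, hβ, inv_mul_cancel₀ hr0]

/-- Theorem 3.2 (i): for a homogeneous cubic polynomial `f` and integers
`1 ≤ r ≤ m` with `m ≥ 3`, one has
`f_{Δ(n,r)} − f_{Δ(n,m)} ≤ ((m−r)(4mr−2m−2r)/(r²(m−1)(m−2)))(\overline f − \underline f)`. -/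
theorem grid_min_diff_le_of_cubic (n : ℕ) (p : MvPolynomial (Fin n) ℝ)
    (hp : p.IsHomogeneous 3) (r m : ℕ) (hr : 1 ≤ r) (hrm : r ≤ m) (hm : 3 ≤ m) :
    gridMin n r (fun x => MvPolynomial.eval x p) -
        gridMin n m (fun x => MvPolynomial.eval x p) ≤
      ((m : ℝ) - r) * (4 * m * r - 2 * m - 2 * r) /
          ((r : ℝ) ^ 2 * ((m : ℝ) - 1) * ((m : ℝ) - 2)) *
        (simplexMax n (fun x => MvPolynomial.eval x p) -
          simplexMin n (fun x => MvPolynomial.eval x p)) := by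
  rcases Nat.eq_zero_or_pos n with rfl | hn
  · have h : stdSimplex ℝ (Fin 0) = ∅ := by
      ext x; simp [stdSimplex]
    have hg : ∀ k, gridSet 0 k = ∅ := fun k => by simp [gridSet, h]
    simp [gridMin, simplexMin, simplexMax, h, hg]
  obtain ⟨T, hT⟩ := hp.exists_eval_eq_cubicForm
  set f : (Fin n → ℝ) → ℝ := fun x => MvPolynomial.eval x p with hf
  have hfT : ∀ x, f x = cubicForm T x := hT
  have hcomp : IsCompact (f '' stdSimplex ℝ (Fin n)) :=
    (isCompact_stdSimplex ℝ (Fin n)).image (MvPolynomial.continuous_eval p)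
  have hlow : ∀ x ∈ stdSimplex ℝ (Fin n), simplexMin n f ≤ f x := fun x hx =>
    csInf_le hcomp.bddBelow ⟨x, hx, rfl⟩
  have hupp : ∀ x ∈ stdSimplex ℝ (Fin n), f x ≤ simplexMax n f := fun x hx =>
    le_csSup hcomp.bddAbove ⟨x, hx, rfl⟩
  have hgrid : ∀ x ∈ gridSet n r, gridMin n r f ≤ f x := fun x hx =>
    csInf_le (hcomp.bddBelow.mono (Set.image_mono fun y hy => hy.1)) ⟨x, hx, rfl⟩
  set L := simplexMin n f
  set M := simplexMax n f
  have hvertex : ∀ i, T i i i = f (Pi.single i 1) := fun i => by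
    rw [hfT, cubicForm_single]
  have hmem : ∀ i : Fin n, (Pi.single i 1 : Fin n → ℝ) ∈ stdSimplex ℝ (Fin n) := fun i =>
    single_mem_stdSimplex ℝ i
  have hne : (gridSet n m).Nonempty :=
    ⟨_, div_mem_gridSet (by omega) (β := Pi.single ⟨0, hn⟩ m) (by simp)⟩
  rw [sub_le_comm]
  refine le_csInf (hne.image f) ?_
  rintro _ ⟨x, ⟨hx, hxm⟩, rfl⟩
  rw [sub_le_comm]
  choose α hα using hxm
  have hαm : ∑ i, α i = m := by
    have : ∑ i, (α i : ℝ) = m := by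
      simp only [← hα, ← Finset.mul_sum, hx.2, mul_one]
    exact_mod_cast this
  have hmain := sub_le_of_cubicForm (fun i j k => T i j k - L) (M - L)
    (fun i => sub_nonneg.mpr (hvertex i ▸ hlow _ (hmem i)))
    (fun i => sub_le_sub_right (hvertex i ▸ hupp _ (hmem i)) L)
    (fun i j => ?_) hr hrm hm (q := gridMin n r f - L) (fun β hβ => ?_) α hαm
    (v := f x - L) (sub_nonneg.mpr (hlow x hx)) ?_
  · linarith
  · have hmid : (fun k => (1 / 2 : ℝ) * (Pi.single i 1 + Pi.single j 1 : Fin n → ℝ) k) ∈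
        stdSimplex ℝ (Fin n) := by
      have := convex_stdSimplex ℝ (Fin n) (hmem i) (hmem j) (a := 1 / 2) (b := 1 / 2)
        (by norm_num) (by norm_num) (by norm_num)
      rw [← smul_add] at this
      exact this
    have h := hupp _ hmid
    rw [hfT, cubicForm_smul] at h
    rw [cubicForm_sub_const]
    have hs : ∑ k, (Pi.single i 1 + Pi.single j 1 : Fin n → ℝ) k = 2 := by
      simp [Finset.sum_add_distrib]; norm_num
    rw [hs]
    linarith
  · have h := hgrid _ (div_mem_gridSet hr hβ)
    have hr0 : (0 : ℝ) < r := by positivity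
    have hs : ∑ i, (β i : ℝ) = r := by exact_mod_cast hβ
    rw [hfT, cubicForm_smul, inv_pow, le_inv_mul_iff₀ (by positivity)] at h
    rw [cubicForm_sub_const, hs]
    linarith
  · have hs : ∑ i, (α i : ℝ) = m := by exact_mod_cast hαm
    rw [cubicForm_sub_const, hs]
    simp only [← hα]
    rw [cubicForm_smul, ← hfT]
    ring
end

section
/- Let f ∈ H_{n,d} be a square-free (multilinear) homogeneous polynomial of degree d, i.e., f = Σ_{I ⊆ {1,…,n}, |I| = d} f_I ∏_{i ∈ I} x_i, and let r, m be integers with 1 ≤ r ≤ m and m ≥ d. Then f_{Δ(n,r)} − f_{Δ(n,m)} ≤ (1 − (r^{\underline{d}}/r^d)·(m^d/m^{\underline{d}})) · (\overline{f} − \underline{f}). -/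
open Finset

theorem MvPolynomial.IsHomogeneous.sum_eq_of_mem_support {n d : ℕ}
    {p : MvPolynomial (Fin n) ℝ} (hp : p.IsHomogeneous d) {s : Fin n →₀ ℕ}
    (hs : s ∈ p.support) : ∑ i, s i = d := by
  rw [hp.degree_eq_sum_deg_support hs]
  exact (s.sum_fintype (fun _ a => a) fun _ => rfl).symm

open MvPolynomial in
/-- A square-free polynomial satisfies a discrete Euler identity. -/
theorem MvPolynomial.IsHomogeneous.sum_mul_eval_sub_single {n d : ℕ}
    {p : MvPolynomial (Fin n) ℝ} (hp : p.IsHomogeneous d)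
    (hsf : ∀ s ∈ p.support, ∀ i, s i ≤ 1) (x : Fin n → ℝ) :
    ∑ i, x i * eval (x - Pi.single i 1) p = ((∑ i, x i) - d) * eval x p := by
  have monomial_identity : ∀ s ∈ p.support, ∀ i,
      x i * ∏ j, (x - Pi.single i 1 : Fin n → ℝ) j ^ s j = (x i - s i) * ∏ j, x j ^ s j := by
    intro s hs i
    rw [← mul_prod_erase univ _ (mem_univ i),
      ← mul_prod_erase univ (fun j => x j ^ s j) (mem_univ i), ← mul_assoc, ← mul_assoc]
    congr 1
    · rcases Nat.le_one_iff_eq_zero_or_eq_one.mp (hsf s hs i) with h | h <;> simp [h]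
      ring
    · refine prod_congr rfl fun j hj => ?_
      simp [Pi.single_eq_of_ne (ne_of_mem_erase hj)]
  simp only [eval_eq', mul_sum]
  rw [sum_comm]
  refine sum_congr rfl fun s hs => ?_
  have hdeg : ∑ i, (s i : ℝ) = d := mod_cast hp.sum_eq_of_mem_support hs
  calc ∑ i, x i * (coeff s p * ∏ j, (x - Pi.single i 1 : Fin n → ℝ) j ^ s j)
      = ∑ i, (x i - s i) * (coeff s p * ∏ j, x j ^ s j) := by
        refine sum_congr rfl fun i _ => ?_
        linear_combination coeff s p * monomial_identity s hs i
    _ = ((∑ i, x i) - d) * (coeff s p * ∏ j, x j ^ s j) := by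
        rw [← sum_mul, sum_sub_distrib, hdeg]

open MvPolynomial in
theorem MvPolynomial.IsHomogeneous.eval_natCast_eq_zero_of_sum_lt {n d : ℕ}
    {p : MvPolynomial (Fin n) ℝ} (hp : p.IsHomogeneous d)
    (hsf : ∀ s ∈ p.support, ∀ i, s i ≤ 1) {k : Fin n → ℕ} (hk : ∑ i, k i < d) :
    eval (fun i => (k i : ℝ)) p = 0 := by
  rw [eval_eq']
  refine sum_eq_zero fun s hs => ?_
  have hdeg : ∑ i, s i = d := hp.sum_eq_of_mem_support hs
  obtain ⟨i, -, hi⟩ := exists_lt_of_sum_lt (hk.trans_eq hdeg.symm)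
  have hki : k i = 0 := by have := hsf s hs i; omega
  rw [prod_eq_zero (mem_univ i), mul_zero]
  rw [hki, Nat.cast_zero, zero_pow (by omega)]

open MvPolynomial in
theorem MvPolynomial.IsHomogeneous.eval_smul {n d : ℕ} {p : MvPolynomial (Fin n) ℝ}
    (hp : p.IsHomogeneous d) (c : ℝ) (x : Fin n → ℝ) :
    eval (c • x) p = c ^ d * eval x p := by
  simp only [eval_eq', mul_sum]
  refine sum_congr rfl fun s hs => ?_
  have hdeg : ∑ i, s i = d := hp.sum_eq_of_mem_support hs
  simp only [Pi.smul_apply, smul_eq_mul, mul_pow, prod_mul_distrib, prod_pow_eq_pow_sum, hdeg]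
  ring

open MvPolynomial in
/-- Some unit of `k` can be removed so that the value of `p` drops at least by the average. -/
theorem MvPolynomial.IsHomogeneous.exists_eval_le_of_sum_succ {n d : ℕ}
    {p : MvPolynomial (Fin n) ℝ} (hp : p.IsHomogeneous d)
    (hsf : ∀ s ∈ p.support, ∀ i, s i ≤ 1) {m : ℕ} {k : Fin n → ℕ} (hk : ∑ i, k i = m + 1) :
    ∃ l : Fin n → ℕ, ∑ i, l i = m ∧
      (m + 1 : ℝ) * eval (fun i => (l i : ℝ)) p ≤ (m + 1 - d) * eval (fun i => (k i : ℝ)) p := by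
  set x : Fin n → ℝ := fun i => (k i : ℝ)
  have hx : ∑ i, x i = m + 1 := by
    simp only [x]
    exact_mod_cast hk
  obtain ⟨i, hki, hi⟩ : ∃ i, 0 < k i ∧
      (m + 1 : ℝ) * eval (x - Pi.single i 1) p ≤ (m + 1 - d) * eval x p := by
    by_contra! h
    obtain ⟨i, -, hki⟩ : ∃ i ∈ univ, 0 < k i := by
      by_contra! h0
      rw [sum_eq_zero fun i hi => Nat.le_zero.mp (h0 i hi)] at hk
      omega
    have hlt : ∑ i, x i * ((m + 1 - d) * eval x p) <
        ∑ i, x i * ((m + 1) * eval (x - Pi.single i 1) p) := by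
      refine sum_lt_sum (fun j _ => ?_) ⟨i, mem_univ i, ?_⟩
      · rcases Nat.eq_zero_or_pos (k j) with hj | hj
        · simp [x, hj]
        · exact mul_le_mul_of_nonneg_left (h j hj).le (Nat.cast_nonneg _)
      · exact mul_lt_mul_of_pos_left (h i hki) (Nat.cast_pos.mpr hki)
    have euler := hp.sum_mul_eval_sub_single hsf x
    simp only [mul_left_comm _ (m + 1 : ℝ), ← mul_sum, ← sum_mul, euler, hx] at hlt
    exact lt_irrefl _ hlt
  refine ⟨Function.update k i (k i - 1), ?_, ?_⟩
  · rw [sum_update_of_mem (mem_univ i)]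
    rw [sum_eq_add_sum_sdiff_singleton_of_mem (mem_univ i)] at hk
    omega
  · convert hi using 4
    ext j
    rcases eq_or_ne j i with rfl | hj
    · simp [x, Nat.cast_sub hki]
    · simp [x, hj]

open MvPolynomial in
theorem MvPolynomial.IsHomogeneous.exists_descFactorial_mul_eval_le {n d : ℕ}
    {p : MvPolynomial (Fin n) ℝ} (hp : p.IsHomogeneous d)
    (hsf : ∀ s ∈ p.support, ∀ i, s i ≤ 1) {r m : ℕ} (hdr : d ≤ r) (hrm : r ≤ m)
    (k : Fin n → ℕ) (hk : ∑ i, k i = m) :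
    ∃ l : Fin n → ℕ, ∑ i, l i = r ∧
      (m.descFactorial d : ℝ) * eval (fun i => (l i : ℝ)) p ≤
        r.descFactorial d * eval (fun i => (k i : ℝ)) p := by
  induction m, hrm using Nat.le_induction generalizing k with
  | base => exact ⟨k, hk, le_rfl⟩
  | succ m hrm ih =>
    obtain ⟨k', hk', hle⟩ := hp.exists_eval_le_of_sum_succ hsf hk
    obtain ⟨l, hl, hle'⟩ := ih k' hk'
    refine ⟨l, hl, ?_⟩
    have hpos : (0 : ℝ) < m + 1 - d := by
      have : (d : ℝ) ≤ m := by exact_mod_cast hdr.trans hrm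
      linarith
    have hfac : (m + 1 - d : ℝ) * (m + 1).descFactorial d = (m + 1) * m.descFactorial d := by
      have := Nat.succ_descFactorial m d
      rw [← Nat.cast_succ, ← Nat.cast_sub (by omega)]
      exact_mod_cast this
    refine le_of_mul_le_mul_left ?_ hpos
    calc (m + 1 - d : ℝ) * ((m + 1).descFactorial d * eval (fun i => (l i : ℝ)) p)
        = (m + 1) * (m.descFactorial d * eval (fun i => (l i : ℝ)) p) := by
          rw [← mul_assoc, hfac, mul_assoc]
      _ ≤ (m + 1) * (r.descFactorial d * eval (fun i => (k' i : ℝ)) p) := by gcongr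
      _ = r.descFactorial d * ((m + 1) * eval (fun i => (k' i : ℝ)) p) := by ring
      _ ≤ r.descFactorial d * ((m + 1 - d) * eval (fun i => (k i : ℝ)) p) := by gcongr
      _ = _ := by ring

theorem Nat.descFactorial_mul_pow_le {r m : ℕ} (hrm : r ≤ m) (d : ℕ) :
    r.descFactorial d * m ^ d ≤ m.descFactorial d * r ^ d := by
  induction d with
  | zero => simp
  | succ d ih =>
    have hstep : (r - d) * m ≤ (m - d) * r := by
      rw [Nat.sub_mul, Nat.sub_mul, Nat.mul_comm m r]
      exact Nat.sub_le_sub_left (Nat.mul_le_mul_left d hrm) _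
    calc r.descFactorial (d + 1) * m ^ (d + 1)
        = ((r - d) * m) * (r.descFactorial d * m ^ d) := by
          rw [Nat.descFactorial_succ]; ring
      _ ≤ ((m - d) * r) * (m.descFactorial d * r ^ d) := Nat.mul_le_mul hstep ih
      _ = m.descFactorial (d + 1) * r ^ (d + 1) := by
          rw [Nat.descFactorial_succ]; ring

theorem inv_smul_natCast_mem_gridSet {n r : ℕ} (hr : 1 ≤ r) {l : Fin n → ℕ}
    (hl : ∑ i, l i = r) : (r : ℝ)⁻¹ • (fun i => (l i : ℝ)) ∈ gridSet n r := by
  have hr0 : (r : ℝ) ≠ 0 := by positivity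
  refine ⟨⟨fun i => ?_, ?_⟩, fun i => ⟨l i, ?_⟩⟩
  · simp only [Pi.smul_apply, smul_eq_mul]
    positivity
  · simp only [Pi.smul_apply, smul_eq_mul, ← mul_sum, ← Nat.cast_sum, hl]
    exact inv_mul_cancel₀ hr0
  · simp only [Pi.smul_apply, smul_eq_mul]
    exact mul_inv_cancel_left₀ hr0 _

theorem exists_inv_smul_natCast_of_mem_gridSet {n m : ℕ} (hm : 1 ≤ m) {x : Fin n → ℝ}
    (hx : x ∈ gridSet n m) :
    ∃ k : Fin n → ℕ, ∑ i, k i = m ∧ x = (m : ℝ)⁻¹ • (fun i => (k i : ℝ)) := by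
  have hm0 : (m : ℝ) ≠ 0 := by positivity
  choose k hk using hx.2
  refine ⟨k, ?_, ?_⟩
  · have : (∑ i, (k i : ℝ)) = m := by
      simp only [← hk, ← mul_sum, hx.1.2, mul_one]
    exact_mod_cast this
  · ext i
    simp only [Pi.smul_apply, smul_eq_mul, ← hk]
    exact (inv_mul_cancel_left₀ hm0 _).symm

theorem isCompact_eval_image_stdSimplex {n : ℕ} (p : MvPolynomial (Fin n) ℝ) :
    IsCompact ((fun x => MvPolynomial.eval x p) '' stdSimplex ℝ (Fin n)) :=
  (isCompact_stdSimplex ℝ (Fin n)).image (MvPolynomial.continuous_eval p)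

theorem gridMin_le {n r : ℕ} (p : MvPolynomial (Fin n) ℝ) {x : Fin n → ℝ}
    (hx : x ∈ gridSet n r) :
    gridMin n r (fun x => MvPolynomial.eval x p) ≤ MvPolynomial.eval x p :=
  csInf_le ((isCompact_eval_image_stdSimplex p).bddBelow.mono
    (Set.image_mono fun _ h => h.1)) ⟨x, hx, rfl⟩

open MvPolynomial in
theorem gridMin_le_mul_eval {n d : ℕ} {p : MvPolynomial (Fin n) ℝ} (hp : p.IsHomogeneous d)
    (hsf : ∀ s ∈ p.support, ∀ i, s i ≤ 1) {r m : ℕ} (hr : 1 ≤ r) (hrm : r ≤ m) (hm : d ≤ m)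
    {x : Fin n → ℝ} (hx : x ∈ gridSet n m) :
    gridMin n r (fun x => eval x p) ≤
      (r.descFactorial d : ℝ) / (r : ℝ) ^ d * ((m : ℝ) ^ d / (m.descFactorial d : ℝ)) *
        eval x p := by
  have hm1 : 1 ≤ m := hr.trans hrm
  have hr0 : (0 : ℝ) < r := by exact_mod_cast hr
  have hm0 : (0 : ℝ) < m := by exact_mod_cast hm1
  have hfac : (0 : ℝ) < m.descFactorial d := by
    exact_mod_cast Nat.pos_of_ne_zero (mt Nat.descFactorial_eq_zero_iff_lt.mp hm.not_gt)
  obtain ⟨k, hk, rfl⟩ := exists_inv_smul_natCast_of_mem_gridSet hm1 hx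
  rcases le_or_gt d r with hdr | hrd
  · obtain ⟨l, hl, hle⟩ := hp.exists_descFactorial_mul_eval_le hsf hdr hrm k hk
    refine (gridMin_le p (inv_smul_natCast_mem_gridSet hr hl)).trans ?_
    rw [hp.eval_smul, hp.eval_smul]
    calc (r : ℝ)⁻¹ ^ d * eval (fun i => (l i : ℝ)) p
        ≤ (r : ℝ)⁻¹ ^ d *
          (r.descFactorial d * eval (fun i => (k i : ℝ)) p / m.descFactorial d) := by
          gcongr
          rw [le_div_iff₀ hfac]
          linarith
      _ = _ := by
          rw [inv_pow, inv_pow]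
          field_simp
  · obtain ⟨i, -⟩ : ∃ i, k i ≠ 0 := by
      by_contra! h
      simp [h] at hk
      omega
    have hl : ∑ j, (Pi.single i r : Fin n → ℕ) j = r := by simp
    refine (gridMin_le p (inv_smul_natCast_mem_gridSet hr hl)).trans ?_
    rw [hp.eval_smul, hp.eval_natCast_eq_zero_of_sum_lt hsf (hl.trans_lt hrd),
      Nat.descFactorial_eq_zero_iff_lt.mpr hrd]
    simp

open MvPolynomial in
theorem simplexMax_nonneg {n d : ℕ} {p : MvPolynomial (Fin n) ℝ} (hp : p.IsHomogeneous d)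
    (hsf : ∀ s ∈ p.support, ∀ i, s i ≤ 1) (hd : 1 < d) (i : Fin n) :
    0 ≤ simplexMax n (fun x => eval x p) := by
  have hsum : ∑ j, (Pi.single i 1 : Fin n → ℕ) j = 1 := by simp
  have hmem := (inv_smul_natCast_mem_gridSet le_rfl hsum).1
  refine le_csSup (isCompact_eval_image_stdSimplex p).bddAbove ⟨_, hmem, ?_⟩
  simp only [hp.eval_smul, hp.eval_natCast_eq_zero_of_sum_lt hsf (hsum.trans_lt hd), mul_zero]

/-- Theorem 3.2 (ii): for a square-free (multilinear) homogeneous polynomial `f` of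
degree `d` and integers `1 ≤ r ≤ m` with `m ≥ d`, one has
`f_{Δ(n,r)} − f_{Δ(n,m)} ≤ (1 − (r^{\underline d}/r^d)(m^d/m^{\underline d}))(\overline f − \underline f)`. -/
theorem grid_min_diff_le_of_squarefree (n d : ℕ) (p : MvPolynomial (Fin n) ℝ)
    (hp : p.IsHomogeneous d) (hsf : ∀ s ∈ p.support, ∀ i, s i ≤ 1)
    (r m : ℕ) (hr : 1 ≤ r) (hrm : r ≤ m) (hm : d ≤ m) :
    gridMin n r (fun x => MvPolynomial.eval x p) -
        gridMin n m (fun x => MvPolynomial.eval x p) ≤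
      (1 - (r.descFactorial d : ℝ) / (r : ℝ) ^ d *
            ((m : ℝ) ^ d / (m.descFactorial d : ℝ))) *
        (simplexMax n (fun x => MvPolynomial.eval x p) -
          simplexMin n (fun x => MvPolynomial.eval x p)) := by
  rcases Nat.eq_zero_or_pos n with rfl | hn
  · simp [gridMin, gridSet, simplexMin, simplexMax, stdSimplex]
  set c : ℝ := (r.descFactorial d : ℝ) / (r : ℝ) ^ d * ((m : ℝ) ^ d / (m.descFactorial d : ℝ))
    with hc
  have hm1 : 1 ≤ m := hr.trans hrm
  have hr0 : (0 : ℝ) < r := by exact_mod_cast hr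
  have hm0 : (0 : ℝ) < m := by exact_mod_cast hm1
  have hfac : (0 : ℝ) < m.descFactorial d := by
    exact_mod_cast Nat.pos_of_ne_zero (mt Nat.descFactorial_eq_zero_iff_lt.mp hm.not_gt)
  have hc1 : c ≤ 1 := by
    rw [hc, div_mul_div_comm, div_le_one (by positivity), mul_comm ((r : ℝ) ^ d)]
    exact_mod_cast Nat.descFactorial_mul_pow_le hrm d
  have hmax : c = 1 ∨ 0 ≤ simplexMax n (fun x => MvPolynomial.eval x p) := by
    rcases le_or_gt d 1 with hd | hd
    · left
      interval_cases d
      · simp [hc]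
      · simp [hc, hr0.ne', hm0.ne']
    · exact Or.inr (simplexMax_nonneg hp hsf hd ⟨0, hn⟩)
  have hne : (gridSet n m).Nonempty :=
    ⟨_, inv_smul_natCast_mem_gridSet hm1 (l := Pi.single ⟨0, hn⟩ m) (by simp)⟩
  rw [sub_le_comm]
  refine le_csInf (hne.image _) ?_
  rintro _ ⟨x, hx, rfl⟩
  have hle := gridMin_le_mul_eval hp hsf hr hrm hm hx
  have hmin : simplexMin n (fun x => MvPolynomial.eval x p) ≤ MvPolynomial.eval x p :=
    csInf_le (isCompact_eval_image_stdSimplex p).bddBelow ⟨x, hx.1, rfl⟩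
  rw [← hc] at hle
  rcases hmax with h1 | h0
  · rw [h1] at hle ⊢
    linarith
  · have := mul_nonneg (sub_nonneg.mpr hc1) (add_nonneg h0 (sub_nonneg.mpr hmin))
    simp only
    linarith
end

section
/- Let f ∈ H_{n,3} be a homogeneous cubic polynomial with a global minimizer x* over Δ_n satisfying x* ∈ Δ(n,m) for some integer m ≥ 3. Then for every integer r with 1 ≤ r ≤ m, f_{Δ(n,r)} − \underline{f} ≤ (m²/(r²(m−2))) · (\overline{f} − \underline{f}). -/
open Finset

/-- The barycenter of the vertices `d a` of the simplex, `a ∈ A`, counted with multiplicity. -/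
noncomputable def vertexAverage {α : Type*} {n : ℕ} (A : Finset α) (d : α → Fin n) :
    Fin n → ℝ :=
  fun i => (∑ a ∈ A, if d a = i then 1 else 0) / (#A : ℝ)

theorem vertexAverage_mem_gridSet {α : Type*} {n : ℕ} {A : Finset α} (hA : A.Nonempty)
    (d : α → Fin n) : vertexAverage A d ∈ gridSet n #A := by
  have hpos : (0 : ℝ) < #A := by exact_mod_cast hA.card_pos
  refine ⟨⟨fun i => ?_, ?_⟩, fun i => ⟨#{a ∈ A | d a = i}, ?_⟩⟩
  · unfold vertexAverage
    positivity
  · simp only [vertexAverage]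
    rw [← Finset.sum_div, Finset.sum_comm]
    simp [hpos.ne']
  · simp only [vertexAverage, mul_div_cancel₀ _ hpos.ne', Finset.sum_boole]

/-- The value of a cubic form with coefficient array `T`, scaled by `#A ^ 3`, at the barycenter
of a family of vertices. -/
theorem cubic_vertexAverage {α : Type*} {n : ℕ} (T : Fin n → Fin n → Fin n → ℝ)
    {A : Finset α} (hA : A.Nonempty) (d : α → Fin n) :
    (#A : ℝ) ^ 3 * ∑ i, ∑ j, ∑ k, T i j k *
        (vertexAverage A d i * vertexAverage A d j * vertexAverage A d k) =
      ∑ a ∈ A, ∑ b ∈ A, ∑ c ∈ A, T (d a) (d b) (d c) := by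
  have hpos : (0 : ℝ) < #A := by exact_mod_cast hA.card_pos
  have key (g : Fin n → ℝ) :
      ∑ i, g i * ((#A : ℝ) * vertexAverage A d i) = ∑ a ∈ A, g (d a) := by
    simp only [vertexAverage, mul_div_cancel₀ _ hpos.ne', Finset.mul_sum]
    rw [Finset.sum_comm]
    simp
  calc
    _ = ∑ i, (∑ j, (∑ k, T i j k * ((#A : ℝ) * vertexAverage A d k)) *
          ((#A : ℝ) * vertexAverage A d j)) * ((#A : ℝ) * vertexAverage A d i) := by
      simp only [Finset.mul_sum, Finset.sum_mul]
      refine Finset.sum_congr rfl fun i _ => Finset.sum_congr rfl fun j _ =>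
        Finset.sum_congr rfl fun k _ => ?_
      ring
    _ = _ := by
      rw [key]
      refine Finset.sum_congr rfl fun a _ => ?_
      rw [key]
      refine Finset.sum_congr rfl fun b _ => ?_
      rw [key]

/-- A homogeneous cubic polynomial is a cubic form given by a coefficient array. -/
theorem MvPolynomial.IsHomogeneous.exists_cubic_array {n : ℕ} {p : MvPolynomial (Fin n) ℝ}
    (hp : p.IsHomogeneous 3) : ∃ T : Fin n → Fin n → Fin n → ℝ,
      ∀ x, MvPolynomial.eval x p = ∑ i, ∑ j, ∑ k, T i j k * (x i * x j * x k) := by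
  have hmon (s : Fin n →₀ ℕ) (hs : s ∈ p.support) : ∃ i j k : Fin n,
      ∀ x : Fin n → ℝ, ∏ l, x l ^ s l = x i * x j * x k := by
    have hdeg : s.degree = 3 := by
      rw [Finsupp.degree_eq_weight_one (R := ℕ)]
      exact hp (MvPolynomial.mem_support_iff.mp hs)
    have hcard : (Finsupp.toMultiset s).card = 3 := by
      rw [Finsupp.card_toMultiset, ← hdeg]
      rfl
    obtain ⟨i, j, k, hijk⟩ := Multiset.card_eq_three.mp hcard
    refine ⟨i, j, k, fun x => ?_⟩
    have := congrArg (fun M => (Multiset.map x M).prod) hijk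
    simp only [Finsupp.toMultiset_map, Finsupp.prod_toMultiset] at this
    rw [Finsupp.prod_mapDomain_index (by simp) (by intros; exact pow_add _ _ _),
      Finsupp.prod_fintype _ _ (by simp)] at this
    rw [this]
    simp [mul_assoc]
  choose I J K h using hmon
  refine ⟨fun i j k => ∑ s ∈ p.support.attach, if I s.1 s.2 = i then if J s.1 s.2 = j then
    if K s.1 s.2 = k then p.coeff s.1 else 0 else 0 else 0, fun x => ?_⟩
  rw [MvPolynomial.eval_eq', ← Finset.sum_attach]
  simp only [Finset.sum_mul]
  simp only [Finset.sum_comm (t := p.support.attach)]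
  refine Finset.sum_congr rfl fun s _ => ?_
  rw [h s.1 s.2]
  simp [ite_mul]

theorem exists_perm_apply_eq_two {α : Type*} {a b x y : α} (hab : a ≠ b) (hxy : x ≠ y) :
    ∃ π : Equiv.Perm α, π x = a ∧ π y = b := by
  have hinj {u v : α} (h : u ≠ v) : Function.Injective ![u, v] := by
    intro i j hij
    fin_cases i <;> fin_cases j <;> simp_all
  obtain ⟨π, hπ⟩ := (Equiv.Perm.isMultiplyPretransitive α 2).exists_smul_eq
    ⟨_, hinj hxy⟩ ⟨_, hinj hab⟩
  exact ⟨π, DFunLike.congr_fun hπ 0, DFunLike.congr_fun hπ 1⟩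

theorem exists_perm_apply_eq_three {α : Type*} {a b c x y z : α} (hab : a ≠ b) (hac : a ≠ c)
    (hbc : b ≠ c) (hxy : x ≠ y) (hxz : x ≠ z) (hyz : y ≠ z) :
    ∃ π : Equiv.Perm α, π x = a ∧ π y = b ∧ π z = c := by
  have hinj {u v w : α} (h₁ : u ≠ v) (h₂ : u ≠ w) (h₃ : v ≠ w) :
      Function.Injective ![u, v, w] := by
    intro i j hij
    fin_cases i <;> fin_cases j <;> simp_all
  obtain ⟨π, hπ⟩ := (Equiv.Perm.isMultiplyPretransitive α 3).exists_smul_eq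
    ⟨_, hinj hxy hxz hyz⟩ ⟨_, hinj hab hac hbc⟩
  exact ⟨π, DFunLike.congr_fun hπ 0, DFunLike.congr_fun hπ 1, DFunLike.congr_fun hπ 2⟩

/-- The sum over a cube `A × A × A` of a function invariant under simultaneous permutations. -/
theorem sum_cube_of_perm_invariant {α : Type*} (G : α → α → α → ℝ)
    (hG : ∀ (π : Equiv.Perm α) (a b c : α), G (π a) (π b) (π c) = G a b c)
    {x y z : α} (hxy : x ≠ y) (hxz : x ≠ z) (hyz : y ≠ z) (A : Finset α) :
    ∑ a ∈ A, ∑ b ∈ A, ∑ c ∈ A, G a b c =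
      #A * G x x x + ((#A : ℝ) ^ 2 - #A) * (G x x y + G x y x + G y x x) +
        ((#A : ℝ) ^ 3 - 3 * (#A : ℝ) ^ 2 + 2 * #A) * G x y z := by
  classical
  have two {a b : α} (hab : a ≠ b) := exists_perm_apply_eq_two hab hxy
  have hpat (a b c : α) : G a b c = G x y z +
      ((if a = b then G x x y - G x y z else 0) + (if a = c then G x y x - G x y z else 0) +
        (if b = c then G y x x - G x y z else 0)) +
      (if a = b then if a = c then
        G x x x - (G x x y + G x y x + G y x x) + 2 * G x y z else 0 else 0) := by
    by_cases hab : a = b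
    · subst hab
      by_cases hac : a = c
      · subst hac
        have := hG (Equiv.swap x a) x x x
        simp only [Equiv.swap_apply_left] at this
        simp only [if_true, this]
        ring
      · obtain ⟨π, rfl, rfl⟩ := two hac
        simp [hac, hG]
    · by_cases hac : a = c
      · subst hac
        obtain ⟨π, rfl, rfl⟩ := two hab
        simp [hG, hxy, hxy.symm]
      · by_cases hbc : b = c
        · subst hbc
          obtain ⟨π, rfl, rfl⟩ := two (Ne.symm hab)
          simp [hG, hxy.symm]
        · obtain ⟨π, rfl, rfl, rfl⟩ := exists_perm_apply_eq_three hab hac hbc hxy hxz hyz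
          simp [hG, hxy, hxz, hyz]
  have hsum : ∑ a ∈ A, ∑ b ∈ A, ∑ c ∈ A, G a b c = ∑ a ∈ A, (#A * (#A * G x y z) +
      (#A * (G x x y - G x y z) + #A * (G x y x - G x y z) + #A * (G y x x - G x y z)) +
        (G x x x - (G x x y + G x y x + G y x x) + 2 * G x y z)) := by
    refine Finset.sum_congr rfl fun a ha => ?_
    refine (Finset.sum_congr rfl fun b _ => Finset.sum_congr rfl fun c _ => hpat a b c).trans ?_
    simp [Finset.sum_add_distrib, Finset.sum_ite_irrel, ha]
    ring
  rw [hsum, Finset.sum_const, nsmul_eq_mul]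
  ring

/-- The elementary estimate behind the grid bound: `s`, `q`, `t` are the sums of the three kinds
of terms (all indices equal, two equal, all distinct), relative to the minimum. -/
theorem grid_estimate {m r s q t v D : ℝ} (hm : 3 ≤ m) (hr : 1 ≤ r) (hrm : r ≤ m)
    (hv : r ^ 2 * v = s + (r - 1) * q + (r - 1) * (r - 2) * t)
    (hzero : 0 = s + (m - 1) * q + (m - 1) * (m - 2) * t)
    (hs : 0 ≤ s) (hsD : s ≤ D) (hsq : s + q ≤ 4 * D) :
    v ≤ m ^ 2 / (r ^ 2 * (m - 2)) * D := by
  have e : (m - 1) * (m - 2) * (r ^ 2 * v) =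
      s * ((m - r) * (m + r - 3)) + q * ((r - 1) * (m - 1) * (m - r)) := by
    linear_combination (m - 1) * (m - 2) * hv - (r - 1) * (r - 2) * hzero
  have hcoef : 0 ≤ (r - 1) * (m - 1) * (m - r) :=
    mul_nonneg (mul_nonneg (by linarith) (by linarith)) (by linarith)
  have h₁ := mul_le_mul_of_nonneg_right (show q ≤ 4 * D - s by linarith) hcoef
  have h₂ : 4 * ((r - 1) * (m - r)) ≤ m ^ 2 := by
    nlinarith [sq_nonneg (2 * r - m - 1)]
  have h₃ : (m - r) * (3 * m * r - 2 * r - 2 * m) ≤ m ^ 2 * (m - 1) := by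
    have hpos : 0 < 4 * (3 * m - 2) := by linarith
    refine le_of_mul_le_mul_left ?_ hpos
    have hgap : 0 ≤ m ^ 2 * (3 * m ^ 2 + 4 * m - 8) :=
      mul_nonneg (sq_nonneg m) (by nlinarith)
    nlinarith [sq_nonneg (2 * (3 * m - 2) * r - 3 * m ^ 2)]
  have h₄ : 4 * ((r - 1) * (m - r)) * (m - 1) ≤ m ^ 2 * (m - 1) :=
    mul_le_mul_of_nonneg_right h₂ (by linarith)
  have h₅ : (m - 1) * ((m - 2) * (r ^ 2 * v)) ≤ (m - 1) * (m ^ 2 * D) := by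
    nlinarith [mul_le_mul_of_nonneg_left h₃ hs, mul_le_mul_of_nonneg_left h₄ (sub_nonneg.2 hsD)]
  have h₆ := le_of_mul_le_mul_left h₅ (by linarith)
  have hden : 0 < r ^ 2 * (m - 2) := mul_pos (by positivity) (by linarith)
  rw [div_mul_eq_mul_div, le_div_iff₀ hden]
  linarith

/-- Some barycenter of `r` of the `m` vertices (with multiplicity) representing a minimizer of a
cubic form satisfies the grid bound. -/
theorem exists_vertexAverage_le {α : Type*} [Fintype α] {n : ℕ}
    {f : (Fin n → ℝ) → ℝ} {T : Fin n → Fin n → Fin n → ℝ}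
    (hT : ∀ x, f x = ∑ i, ∑ j, ∑ k, T i j k * (x i * x j * x k)) (d : α → Fin n)
    {L U : ℝ} (hL : f (vertexAverage univ d) = L)
    (hbound : ∀ x ∈ stdSimplex ℝ (Fin n), L ≤ f x ∧ f x ≤ U)
    (hcard : 3 ≤ Fintype.card α) {A : Finset α} (hA : A.Nonempty) :
    ∃ e : α → Fin n, f (vertexAverage A e) - L ≤
      (Fintype.card α : ℝ) ^ 2 / ((#A : ℝ) ^ 2 * ((Fintype.card α : ℝ) - 2)) * (U - L) := by
  classical
  obtain ⟨x, y, z, hxy, hxz, hyz⟩ := Fintype.two_lt_card_iff.mp hcard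
  set G : α → α → α → ℝ :=
    fun a b c => ∑ σ : Equiv.Perm α, T (d (σ a)) (d (σ b)) (d (σ c)) with hGdef
  have hG (π : Equiv.Perm α) (a b c : α) : G (π a) (π b) (π c) = G a b c :=
    Equiv.sum_comp (Equiv.mulRight π) fun σ => T (d (σ a)) (d (σ b)) (d (σ c))
  have hval (B : Finset α) (hB : B.Nonempty) :
      (#B : ℝ) ^ 3 * ∑ σ : Equiv.Perm α, f (vertexAverage B (d ∘ σ)) =
        #B * G x x x + ((#B : ℝ) ^ 2 - #B) * (G x x y + G x y x + G y x x) +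
          ((#B : ℝ) ^ 3 - 3 * (#B : ℝ) ^ 2 + 2 * #B) * G x y z := by
    rw [← sum_cube_of_perm_invariant G hG hxy hxz hyz B, Finset.mul_sum]
    simp only [hT, cubic_vertexAverage T hB, Function.comp_apply, hGdef]
    simp only [Finset.sum_comm (s := B) (t := (univ : Finset (Equiv.Perm α)))]
  have hfull (σ : Equiv.Perm α) : vertexAverage univ (d ∘ σ) = vertexAverage univ d := by
    ext i
    simp only [vertexAverage, Function.comp_apply]
    rw [Equiv.sum_comp σ fun a => if d a = i then (1 : ℝ) else 0]
  have hN : 0 < (Fintype.card (Equiv.Perm α) : ℝ) := by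
    exact Nat.cast_pos.mpr Fintype.card_pos
  set N := (Fintype.card (Equiv.Perm α) : ℝ) with hNdef
  have hbd (B : Finset α) (hB : B.Nonempty) :
      N * L ≤ ∑ σ : Equiv.Perm α, f (vertexAverage B (d ∘ σ)) ∧
        ∑ σ : Equiv.Perm α, f (vertexAverage B (d ∘ σ)) ≤ N * U := by
    have hmem (σ : Equiv.Perm α) := hbound _ (vertexAverage_mem_gridSet hB (d ∘ σ)).1
    constructor
    · have := Finset.card_nsmul_le_sum (univ : Finset (Equiv.Perm α))
        (fun σ => f (vertexAverage B (d ∘ σ))) L fun σ _ => (hmem σ).1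
      simpa [hNdef] using this
    · have := Finset.sum_le_card_nsmul (univ : Finset (Equiv.Perm α))
        (fun σ => f (vertexAverage B (d ∘ σ))) U fun σ _ => (hmem σ).2
      simpa [hNdef] using this
  have h₁ := hval {x} (by simp)
  have hb₁ := hbd {x} (by simp)
  have h₂ := hval {x, y} (by simp)
  have hb₂ := hbd {x, y} (by simp)
  have hm := hval univ ⟨x, mem_univ x⟩
  have hr := hval A hA
  simp only [hfull, hL, Finset.sum_const, nsmul_eq_mul, Finset.card_univ, ← hNdef] at hm
  simp only [Finset.card_singleton, Finset.card_pair hxy] at h₁ h₂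
  norm_num at h₁ h₂
  have hm3 : (3 : ℝ) ≤ Fintype.card α := by exact_mod_cast hcard
  have hr1 : (1 : ℝ) ≤ #A := by exact_mod_cast hA.card_pos
  have hrm : (#A : ℝ) ≤ Fintype.card α := by exact_mod_cast Finset.card_le_univ A
  set m := (Fintype.card α : ℝ)
  set r := (#A : ℝ)
  set V := ∑ σ : Equiv.Perm α, f (vertexAverage A (d ∘ σ)) with hV
  have hest : V - N * L ≤ m ^ 2 / (r ^ 2 * (m - 2)) * (N * U - N * L) := by
    refine grid_estimate (s := G x x x - N * L)
      (q := G x x y + G x y x + G y x x - 3 * (N * L)) (t := G x y z - N * L)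
      hm3 hr1 hrm ?_ ?_ (by linarith) (by linarith) (by linarith)
    · refine mul_left_cancel₀ (show r ≠ 0 by linarith) ?_
      linear_combination hr
    · refine mul_left_cancel₀ (show m ≠ 0 by linarith) ?_
      linear_combination hm
  by_contra! hcon
  have hlt := Finset.sum_lt_sum_of_nonempty (univ_nonempty (α := Equiv.Perm α))
    fun σ _ => hcon (d ∘ σ)
  simp only [Finset.sum_sub_distrib, Finset.sum_const, nsmul_eq_mul, Finset.card_univ,
    ← hNdef, ← hV] at hlt
  linarith

/-- Corollary 3.3, first case: if a homogeneous cubic `f` has a global minimizer over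
the simplex lying in `Δ(n,m)` with `m ≥ 3`, then for every `1 ≤ r ≤ m`,
`f_{Δ(n,r)} − \underline f ≤ (m²/(r²(m−2)))(\overline f − \underline f)`. -/
theorem cubic_rational_minimizer_small_r (n : ℕ) (p : MvPolynomial (Fin n) ℝ)
    (hp : p.IsHomogeneous 3) (m : ℕ) (hm : 3 ≤ m)
    (xstar : Fin n → ℝ) (hxstar : xstar ∈ gridSet n m)
    (hmin : ∀ x ∈ stdSimplex ℝ (Fin n),
      MvPolynomial.eval xstar p ≤ MvPolynomial.eval x p)
    (r : ℕ) (hr : 1 ≤ r) (hrm : r ≤ m) :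
    gridMin n r (fun x => MvPolynomial.eval x p) -
        simplexMin n (fun x => MvPolynomial.eval x p) ≤
      (m : ℝ) ^ 2 / ((r : ℝ) ^ 2 * ((m : ℝ) - 2)) *
        (simplexMax n (fun x => MvPolynomial.eval x p) -
          simplexMin n (fun x => MvPolynomial.eval x p)) := by
  obtain ⟨hx, hgrid⟩ := hxstar
  obtain ⟨T, hT⟩ := hp.exists_cubic_array
  choose k hk using hgrid
  have hm0 : (m : ℝ) ≠ 0 := by
    have : m ≠ 0 := by omega
    exact_mod_cast this
  have hcard : Fintype.card (Σ i, Fin (k i)) = m := by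
    have hsum : (∑ i, (k i : ℝ)) = m := by
      simp only [← hk, ← Finset.mul_sum, hx.2, mul_one]
    rw [Fintype.card_sigma]
    simp only [Fintype.card_fin]
    exact_mod_cast hsum
  have havg : vertexAverage univ (Sigma.fst : (Σ i, Fin (k i)) → Fin n) = xstar := by
    ext i
    rw [vertexAverage, Finset.card_univ, hcard, div_eq_iff hm0, mul_comm, hk i,
      Fintype.sum_sigma, Finset.sum_eq_single i (fun j _ hj => by simp [hj]) (by simp)]
    simp
  have hcont : Continuous fun x => MvPolynomial.eval x p := p.continuous_eval
  have hbdd : BddAbove ((fun x => MvPolynomial.eval x p) '' stdSimplex ℝ (Fin n)) :=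
    ((isCompact_stdSimplex ℝ (Fin n)).image hcont).bddAbove
  have hmin_eq : simplexMin n (fun x => MvPolynomial.eval x p) = MvPolynomial.eval xstar p := by
    refine IsLeast.csInf_eq ⟨⟨xstar, hx, rfl⟩, ?_⟩
    rintro _ ⟨x, hx', rfl⟩
    exact hmin x hx'
  obtain ⟨A, -, hA⟩ := Finset.exists_subset_card_eq
    (s := (univ : Finset (Σ i, Fin (k i)))) (n := r) (by rw [Finset.card_univ, hcard]; exact hrm)
  have hAne : A.Nonempty := Finset.card_pos.mp (by omega)
  obtain ⟨e, he⟩ := exists_vertexAverage_le (f := fun x => MvPolynomial.eval x p) hT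
    Sigma.fst (L := MvPolynomial.eval xstar p)
    (U := simplexMax n (fun x => MvPolynomial.eval x p)) (by rw [havg])
    (fun x hx' => ⟨hmin x hx', le_csSup hbdd ⟨x, hx', rfl⟩⟩) (by omega) hAne
  rw [hcard, hA] at he
  have hmem : vertexAverage A e ∈ gridSet n r := hA ▸ vertexAverage_mem_gridSet hAne e
  have hle : gridMin n r (fun x => MvPolynomial.eval x p) ≤
      MvPolynomial.eval (vertexAverage A e) p := by
    refine csInf_le ⟨MvPolynomial.eval xstar p, ?_⟩ ⟨_, hmem, rfl⟩
    rintro _ ⟨x, hx', rfl⟩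
    exact hmin x hx'.1
  rw [hmin_eq]
  linarith
end

section
/- Let f ∈ H_{n,3} be a homogeneous cubic polynomial with a global minimizer x* over Δ_n satisfying x* ∈ Δ(n,m) for some integer m ≥ 3. Then for every integer r with r > m, f_{Δ(n,r)} − \underline{f} ≤ (6m/r²) · (\overline{f} − \underline{f}). -/
open Finset

/-- Every homogeneous cubic polynomial is the diagonal restriction of a trilinear form. -/
lemma MvPolynomial.IsHomogeneous.exists_trilinear {n : ℕ} {p : MvPolynomial (Fin n) ℝ}
    (hp : p.IsHomogeneous 3) :
    ∃ T : Fin n → Fin n → Fin n → ℝ, ∀ x : Fin n → ℝ,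
      MvPolynomial.eval x p = ∑ i, ∑ j, ∑ k, T i j k * (x i * x j * x k) := by
  have hmono : ∀ d ∈ p.support, ∃ i j k : Fin n, ∀ x : Fin n → ℝ,
      ∏ l, x l ^ d l = x i * x j * x k := by
    intro d hd
    have hdeg : d.degree = 3 := by
      rw [Finsupp.degree_eq_weight_one]
      exact hp (MvPolynomial.mem_support_iff.mp hd)
    have hcard : Multiset.card (Finsupp.toMultiset d) = 3 := by
      rw [Finsupp.card_toMultiset, ← hdeg]
      rfl
    obtain ⟨i, j, k, hijk⟩ := Multiset.card_eq_three.mp hcard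
    refine ⟨i, j, k, fun x => ?_⟩
    have h := congrArg (fun s => (Multiset.map x s).prod) hijk
    simp only [Finsupp.toMultiset_map, Finsupp.prod_toMultiset] at h
    rw [Finsupp.prod_mapDomain_index (by simp) (by intros; exact pow_add _ _ _),
      Finsupp.prod_fintype _ _ (by simp)] at h
    rw [h]
    simp [mul_assoc]
  replace hmono : ∀ d : p.support, ∃ i j k : Fin n, ∀ x : Fin n → ℝ,
      ∏ l, x l ^ d.1 l = x i * x j * x k := fun d => hmono d.1 d.2
  choose i j k hijk using hmono
  refine ⟨fun a b c => ∑ d : p.support,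
    if a = i d then if b = j d then if c = k d then p.coeff d else 0 else 0 else 0, fun x => ?_⟩
  rw [MvPolynomial.eval_eq', ← Finset.sum_coe_sort]
  have hswap : ∀ a b c, (∑ d : p.support,
      if a = i d then if b = j d then if c = k d then p.coeff d else 0 else 0 else 0) *
        (x a * x b * x c) = ∑ d : p.support,
      if a = i d then if b = j d then if c = k d then p.coeff d * (x a * x b * x c)
        else 0 else 0 else 0 := by
    intro a b c
    rw [Finset.sum_mul]
    refine Finset.sum_congr rfl fun d _ => ?_
    split_ifs <;> simp
  simp only [hswap]
  have hcomm : ∀ g : Fin n → Fin n → Fin n → p.support → ℝ,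
      ∑ a, ∑ b, ∑ c, ∑ d, g a b c d = ∑ d, ∑ a, ∑ b, ∑ c, g a b c d := by
    intro g
    rw [Finset.sum_comm (s := (univ : Finset p.support))]
    refine Finset.sum_congr rfl fun a _ => ?_
    rw [Finset.sum_comm (s := (univ : Finset p.support))]
    refine Finset.sum_congr rfl fun b _ => ?_
    rw [Finset.sum_comm (s := (univ : Finset p.support))]
  rw [hcomm]
  refine Finset.sum_congr rfl fun d _ => ?_
  rw [hijk d x, Finset.sum_eq_single (i d) (by intro a _ h; simp [h]) (by simp)]
  simp

/-- The sum of a function of three variables over the triples of an `r`-subset, added up over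
all `r`-subsets. -/
lemma sum_powersetCard_sum_triple {ι : Type*} [Fintype ι] [DecidableEq ι] {r : ℕ} (hr : 3 ≤ r)
    (t : ι → ι → ι → ℝ) (w : ℕ → ℝ)
    (hw : ∀ k, w k = ((Fintype.card ι - k).choose (r - k) : ℕ)) :
    ∑ S ∈ powersetCard r (univ : Finset ι), ∑ a ∈ S, ∑ b ∈ S, ∑ c ∈ S, t a b c =
      w 3 * ∑ a, ∑ b, ∑ c, t a b c +
      (w 2 - w 3) * ∑ a, ∑ b, (t a a b + t a b a + t b a a) +
      (w 1 - 3 * w 2 + 2 * w 3) * ∑ a, t a a a := by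
  have hind : ∀ S : Finset ι, ∑ a ∈ S, ∑ b ∈ S, ∑ c ∈ S, t a b c =
      ∑ a, ∑ b, ∑ c, if ({a, b, c} : Finset ι) ⊆ S then t a b c else 0 := by
    intro S
    simp only [Finset.insert_subset_iff, Finset.singleton_subset_iff, ite_and]
    rw [← Finset.sum_filter_of_ne (s := univ) (p := (· ∈ S))]
    · simp only [Finset.filter_univ_mem]
      refine Finset.sum_congr rfl fun a ha => ?_
      simp [ha, Finset.sum_ite_irrel, Finset.sum_ite_mem]
    · intro a _ h
      by_contra h'
      exact h (by simp [h'])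
  have hsum : ∑ S ∈ powersetCard r (univ : Finset ι), ∑ a ∈ S, ∑ b ∈ S, ∑ c ∈ S, t a b c =
      ∑ a, ∑ b, ∑ c, w (#({a, b, c} : Finset ι)) * t a b c := by
    simp only [hind]
    rw [Finset.sum_comm]
    refine Finset.sum_congr rfl fun a _ => ?_
    rw [Finset.sum_comm]
    refine Finset.sum_congr rfl fun b _ => ?_
    rw [Finset.sum_comm]
    refine Finset.sum_congr rfl fun c _ => ?_
    rw [← Finset.sum_filter, Finset.sum_const, Finset.card_filter_powersetCard_subset _ _ _
      (Finset.subset_univ _) (Finset.card_le_three.trans hr), hw, Finset.card_univ, nsmul_eq_mul]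
  have hweight : ∀ a b c : ι, w (#({a, b, c} : Finset ι)) * t a b c =
      w 3 * t a b c + (w 2 - w 3) * ((if b = a then t a b c else 0) +
        (if c = a then t a b c else 0) + (if c = b then t a b c else 0)) +
      (w 1 - 3 * w 2 + 2 * w 3) * (if b = a then if c = a then t a b c else 0 else 0) := by
    intro a b c
    by_cases hab : b = a
    · subst hab
      by_cases hcb : c = b
      · subst hcb
        simp
        ring
      · have : #({b, b, c} : Finset ι) = 2 := by simp [Finset.card_pair (Ne.symm hcb)]
        simp only [this, hcb, if_true, if_false]
        ring
    · by_cases hca : c = a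
      · subst hca
        have : #({c, b, c} : Finset ι) = 2 := by
          rw [Finset.pair_comm, Finset.insert_idem, Finset.card_pair (Ne.symm hab)]
        simp only [this, hab, Ne.symm hab, if_true, if_false]
        ring
      · by_cases hcb : c = b
        · subst hcb
          have : #({a, c, c} : Finset ι) = 2 := by simp [Finset.card_pair (Ne.symm hab)]
          simp only [this, hab, if_true, if_false]
          ring
        · have : #({a, b, c} : Finset ι) = 3 :=
            Finset.card_eq_three.mpr ⟨a, b, c, Ne.symm hab, Ne.symm hca, Ne.symm hcb, rfl⟩
          simp only [this, hab, hca, hcb, if_false]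
          ring
  rw [hsum]
  simp only [hweight, Finset.sum_add_distrib, ← Finset.mul_sum]
  congr 1
  · congr 3
    · congr 1
      · refine Finset.sum_congr rfl fun a _ => ?_
        rw [Finset.sum_comm]
        simp
      · simp
    · rw [Finset.sum_comm]
      simp
  · congr 1
    refine Finset.sum_congr rfl fun a _ => ?_
    rw [Finset.sum_eq_single a (by intro b _ h; simp [h]) (by simp)]
    simp

/-- A function of three variables on `M` points with vanishing total sum has an `r`-subset on
which its sum is small, provided that its values are controlled on pairs. -/
lemma exists_powersetCard_sum_triple_le {ι : Type*} [Fintype ι] [DecidableEq ι] {r m : ℕ}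
    (hr : 3 ≤ r) (hM : 6 ≤ Fintype.card ι) (hrM : r ≤ Fintype.card ι)
    (hMr : Fintype.card ι ≤ r + m) (t : ι → ι → ι → ℝ) (F : ℝ)
    (hnonneg : ∀ a, 0 ≤ t a a a)
    (hpair : ∀ a b, t a a a + t b b b + (t a a b + t a b a + t b a a) +
      (t b b a + t b a b + t a b b) ≤ 8 * F)
    (hzero : ∑ a, ∑ b, ∑ c, t a b c = 0) :
    ∃ S ∈ powersetCard r (univ : Finset ι),
      ∑ a ∈ S, ∑ b ∈ S, ∑ c ∈ S, t a b c ≤ 6 * m * r * F := by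
  set w : ℕ → ℝ := fun k => ((Fintype.card ι - k).choose (r - k) : ℕ) with hw
  set N : ℝ := (Fintype.card ι : ℝ) with hN
  set Q : ℝ := ∑ a, ∑ b, (t a a b + t a b a + t b a a) with hQ
  set R : ℝ := ∑ a, t a a a with hR
  have hne : (powersetCard r (univ : Finset ι)).Nonempty :=
    Finset.powersetCard_nonempty.mpr (by simpa using hrM)
  refine Finset.exists_le_of_sum_le hne ?_
  rw [sum_powersetCard_sum_triple hr t w (fun _ => rfl), hzero, Finset.sum_const,
    Finset.card_powersetCard, Finset.card_univ, nsmul_eq_mul]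
  have hR0 : 0 ≤ R := Finset.sum_nonneg fun a _ => hnonneg a
  have hF : 0 ≤ F := by
    have : Nonempty ι := Fintype.card_pos_iff.mp (by omega)
    obtain ⟨a⟩ := this
    linarith [hpair a a, hnonneg a]
  have hQR : Q ≤ 4 * F * N ^ 2 - N * R := by
    have hexp : ∀ (u : ι → ℝ) (v : ι → ι → ℝ), ∑ a, ∑ b, (u a + u b + v a b + v b a) =
        2 * (N * ∑ a, u a) + 2 * ∑ a, ∑ b, v a b := by
      intro u v
      simp only [Finset.sum_add_distrib, Finset.sum_const, Finset.card_univ, nsmul_eq_mul,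
        ← Finset.mul_sum, ← hN]
      rw [Finset.sum_comm (f := fun a b => v b a)]
      ring
    have h := Finset.sum_le_sum fun a (_ : a ∈ (univ : Finset ι)) =>
      Finset.sum_le_sum fun b (_ : b ∈ (univ : Finset ι)) => hpair a b
    rw [hexp (fun a => t a a a) (fun a b => t a a b + t a b a + t b a a), ← hQ, ← hR] at h
    simp only [Finset.sum_const, Finset.card_univ, nsmul_eq_mul, ← hN] at h
    linarith
  have hstep : ∀ M s : ℕ, 1 ≤ M → 1 ≤ s →
      (M : ℝ) * ((M - 1).choose (s - 1) : ℕ) = s * (M.choose s : ℕ) := by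
    intro M s h1 h2
    obtain ⟨M, rfl⟩ := Nat.exists_eq_add_of_le' h1
    obtain ⟨s, rfl⟩ := Nat.exists_eq_add_of_le' h2
    have := Nat.add_one_mul_choose_eq M s
    rw [mul_comm (Nat.choose _ _)] at this
    exact_mod_cast this
  have h1 : N * w 1 = r * w 0 := hstep _ _ (by omega) (by omega)
  have h2 : (N - 1) * w 2 = (r - 1) * w 1 := by
    have := hstep (Fintype.card ι - 1) (r - 1) (by omega) (by omega)
    rw [Nat.cast_sub (by omega), Nat.cast_sub (by omega)] at this
    simpa [hw, Nat.sub_sub] using this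
  have h3 : (N - 2) * w 3 = (r - 2) * w 2 := by
    have := hstep (Fintype.card ι - 2) (r - 2) (by omega) (by omega)
    rw [Nat.cast_sub (by omega), Nat.cast_sub (by omega)] at this
    simpa [hw, Nat.sub_sub] using this
  have hN6 : (6 : ℝ) ≤ N := by rw [hN]; exact_mod_cast hM
  have hr3 : (3 : ℝ) ≤ r := by exact_mod_cast hr
  have hrN : (r : ℝ) ≤ N := by rw [hN]; exact_mod_cast hrM
  have hNr : N ≤ r + m := by rw [hN]; exact_mod_cast hMr
  have hw0 : 0 ≤ w 0 := Nat.cast_nonneg _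
  change _ ≤ w 0 * _
  have hw1 : w 1 = r * w 0 / N := by field_simp; linarith
  have hN1 : 0 < N - 1 := by linarith
  have hN2 : 0 < N - 2 := by linarith
  have hw2 : w 2 = r * (r - 1) * w 0 / (N * (N - 1)) := by
    rw [eq_div_iff (by positivity)]; linear_combination N * h2 + (r - 1) * h1
  have hw3 : w 3 = r * (r - 1) * (r - 2) * w 0 / (N * (N - 1) * (N - 2)) := by
    rw [eq_div_iff (by positivity)]
    linear_combination N * (N - 1) * h3 + (r - 2) * N * h2 + (r - 2) * (r - 1) * h1
  set D : ℝ := N * (N - 1) * (N - 2) with hD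
  have hDpos : 0 < D := by positivity
  have hc2 : w 2 - w 3 = r * (r - 1) * (N - r) * w 0 / D := by
    rw [hw2, hw3, hD]; field_simp; ring
  have hc1 : w 1 - 3 * w 2 + 2 * w 3 = r * (N - r) * (N - 2 * r) * w 0 / D := by
    rw [hw1, hw2, hw3, hD]; field_simp; ring
  have hr1 : 0 ≤ (r : ℝ) - 1 := by linarith
  have hNr0 : 0 ≤ N - r := by linarith
  rw [hc2, hc1, mul_zero, zero_add]
  have hcQ : 0 ≤ r * (r - 1) * (N - r) * w 0 / D := by positivity
  calc r * (r - 1) * (N - r) * w 0 / D * Q + r * (N - r) * (N - 2 * r) * w 0 / D * R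
      ≤ r * (r - 1) * (N - r) * w 0 / D * (4 * F * N ^ 2 - N * R) +
        r * (N - r) * (N - 2 * r) * w 0 / D * R := by gcongr
    _ = r * (N - r) * w 0 / D * (4 * F * N ^ 2 * (r - 1)) -
        r * (N - r) * w 0 / D * (R * (N * (r - 1) - (N - 2 * r))) := by ring
    _ ≤ r * (N - r) * w 0 / D * (4 * F * N ^ 2 * (r - 1)) := by
        have : 0 ≤ N * (r - 1) - (N - 2 * r) := by nlinarith
        exact sub_le_self _ (by positivity)
    _ ≤ r * m * w 0 / D * (F * (6 * D)) := by
        rcases hrN.lt_or_eq with hlt | heq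
        · have hrN1 : (r : ℝ) + 1 ≤ N := by
            have : r < Fintype.card ι := by rw [hN] at hlt; exact_mod_cast hlt
            rw [hN]
            exact_mod_cast this
          have hb : 4 * N ^ 2 * (r - 1) ≤ 6 * D := by
            calc 4 * N ^ 2 * (r - 1) ≤ 4 * N ^ 2 * (N - 2) := by gcongr _ * ?_; linarith
              _ = N * (N - 2) * (4 * N) := by ring
              _ ≤ N * (N - 2) * (6 * (N - 1)) := by gcongr ?_ * ?_; linarith
              _ = 6 * D := by rw [hD]; ring
          have hb' : 4 * F * N ^ 2 * (r - 1) ≤ F * (6 * D) := by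
            calc _ = F * (4 * N ^ 2 * (r - 1)) := by ring
              _ ≤ _ := by gcongr
          gcongr
          linarith
        · rw [heq, sub_self]
          simp only [mul_zero, zero_mul, zero_div]
          positivity
    _ = w 0 * (6 * m * r * F) := by field_simp

/-- A trilinear form evaluated at the normalised colour counts of a finite set. -/
lemma trilinear_count_div {ι : Type*} {n : ℕ} (c : ι → Fin n)
    (S : Finset ι) (r : ℝ) (T : Fin n → Fin n → Fin n → ℝ) (x : Fin n → ℝ)
    (hx : ∀ i, x i = #{a ∈ S | c a = i} / r) :
    ∑ i, ∑ j, ∑ k, T i j k * (x i * x j * x k) =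
      (∑ a ∈ S, ∑ b ∈ S, ∑ d ∈ S, T (c a) (c b) (c d)) / r ^ 3 := by
  have key : ∀ h : Fin n → ℝ, ∑ i, x i * h i = (∑ a ∈ S, h (c a)) / r := by
    intro h
    rw [← Finset.sum_fiberwise S c, Finset.sum_div]
    refine Finset.sum_congr rfl fun i _ => ?_
    rw [Finset.sum_congr rfl (g := fun _ => h i)
      (by intro a ha; rw [(Finset.mem_filter.mp ha).2]), Finset.sum_const, nsmul_eq_mul, hx]
    ring
  have : ∑ i, ∑ j, ∑ k, T i j k * (x i * x j * x k) =
      ∑ i, x i * ∑ j, x j * ∑ k, x k * T i j k := by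
    simp only [Finset.mul_sum]
    refine Finset.sum_congr rfl fun i _ => Finset.sum_congr rfl fun j _ =>
      Finset.sum_congr rfl fun k _ => by ring
  rw [this]
  simp only [key, ← Finset.sum_div]
  rw [div_div, div_div]
  ring_nf

/-- The normalised colour counts of an `r`-element set form a point of the grid. -/
lemma count_div_mem_gridSet {ι : Type*} {n r : ℕ} (hr : r ≠ 0) (c : ι → Fin n) {S : Finset ι}
    (hS : #S = r) : (fun i => (#{a ∈ S | c a = i} : ℝ) / r) ∈ gridSet n r := by
  have hr' : (r : ℝ) ≠ 0 := by exact_mod_cast hr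
  refine ⟨⟨fun i => by positivity, ?_⟩, fun i => ⟨_, mul_div_cancel₀ _ hr'⟩⟩
  rw [← Finset.sum_div, div_eq_one_iff_eq hr', ← hS]
  exact_mod_cast (Finset.card_eq_sum_card_fiberwise (fun a _ => Finset.mem_univ (c a))).symm

/-- A point of the grid with denominator `m` is the normalised vector of colour counts of a
finite type with `m * q` elements, for every `q ≥ 1`. -/
lemma exists_count_of_mem_gridSet {n m : ℕ} (hm : m ≠ 0) {x : Fin n → ℝ} (hx : x ∈ gridSet n m)
    {q : ℕ} (hq : q ≠ 0) :
    ∃ c : Fin (m * q) → Fin n, ∀ i, x i = (#{a | c a = i} : ℝ) / (m * q : ℕ) := by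
  obtain ⟨⟨-, hsum⟩, hgrid⟩ := hx
  choose k hk using hgrid
  have hcard : Fintype.card (Σ i, Fin (k i * q)) = m * q := by
    simp only [Fintype.card_sigma, Fintype.card_fin, ← Finset.sum_mul]
    congr 1
    have : (∑ i, (k i : ℝ)) = m := by
      simp only [← hk, ← Finset.mul_sum, hsum, mul_one]
    exact_mod_cast this
  let e := (Fintype.equivFinOfCardEq hcard).symm
  refine ⟨fun a => (e a).1, fun i => ?_⟩
  have hcount : #{a | (e a).1 = i} = k i * q := by
    rw [Finset.card_equiv e (t := {s | s.1 = i}) (by simp), Finset.card_filter,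
      Fintype.sum_sigma, Finset.sum_eq_single i (by intro j _ h; simp [h]) (by simp)]
    simp
  rw [hcount]
  have hm' : (m : ℝ) ≠ 0 := by exact_mod_cast hm
  have hq' : (q : ℝ) ≠ 0 := by exact_mod_cast hq
  push_cast
  rw [← hk]
  field_simp

/-- Corollary 3.3, second case: if a homogeneous cubic `f` has a global minimizer over
the simplex lying in `Δ(n,m)` with `m ≥ 3`, then for every integer `r > m`,
`f_{Δ(n,r)} − \underline f ≤ (6m/r²)(\overline f − \underline f)`. -/
theorem cubic_rational_minimizer_large_r (n : ℕ) (p : MvPolynomial (Fin n) ℝ)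
    (hp : p.IsHomogeneous 3) (m : ℕ) (hm : 3 ≤ m)
    (xstar : Fin n → ℝ) (hxstar : xstar ∈ gridSet n m)
    (hmin : ∀ x ∈ stdSimplex ℝ (Fin n),
      MvPolynomial.eval xstar p ≤ MvPolynomial.eval x p)
    (r : ℕ) (hr : m < r) :
    gridMin n r (fun x => MvPolynomial.eval x p) -
        simplexMin n (fun x => MvPolynomial.eval x p) ≤
      6 * (m : ℝ) / (r : ℝ) ^ 2 *
        (simplexMax n (fun x => MvPolynomial.eval x p) -
          simplexMin n (fun x => MvPolynomial.eval x p)) := by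
  set f : (Fin n → ℝ) → ℝ := fun x => MvPolynomial.eval x p with hf
  have hcompact : IsCompact (f '' stdSimplex ℝ (Fin n)) :=
    (isCompact_stdSimplex ℝ (Fin n)).image (MvPolynomial.continuous_eval p)
  have hle_max : ∀ x ∈ stdSimplex ℝ (Fin n), f x ≤ simplexMax n f := fun x hx =>
    le_csSup hcompact.bddAbove (Set.mem_image_of_mem f hx)
  have hsmin : simplexMin n f = f xstar :=
    IsLeast.csInf_eq ⟨Set.mem_image_of_mem f hxstar.1, by
      rintro _ ⟨x, hx, rfl⟩
      exact hmin x hx⟩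
  have hgrid_le : ∀ x ∈ gridSet n r, gridMin n r f ≤ f x := fun x hx =>
    csInf_le (hcompact.bddBelow.mono (Set.image_mono fun _ h => h.1)) (Set.mem_image_of_mem f hx)
  obtain ⟨T, hT⟩ := hp.exists_trilinear
  have hT' : ∀ x ∈ stdSimplex ℝ (Fin n),
      ∑ i, ∑ j, ∑ k, (T i j k - f xstar) * (x i * x j * x k) = f x - f xstar := by
    intro x hx
    simp only [sub_mul, Finset.sum_sub_distrib, ← hT, ← Finset.mul_sum, hx.2, mul_one]
    rfl
  obtain ⟨q, hq1, hq2⟩ : ∃ q, r ≤ m * q ∧ m * q ≤ r + m := by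
    refine ⟨r / m + 1, (Nat.lt_mul_div_succ r (by omega)).le, ?_⟩
    rw [mul_add, mul_one]
    exact Nat.add_le_add_right (Nat.mul_div_le r m) m
  have hq : 2 ≤ q := by
    by_contra! h
    have : m * q ≤ m * 1 := Nat.mul_le_mul_left m (by omega)
    omega
  obtain ⟨c, hc⟩ := exists_count_of_mem_gridSet (by omega) hxstar (q := q) (by omega)
  have hmq : m * q ≠ 0 := by positivity
  have hzero := trilinear_count_div c univ (m * q : ℕ) (fun i j k => T i j k - f xstar) xstar hc
  rw [hT' xstar hxstar.1, sub_self, eq_comm, div_eq_zero_iff,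
    or_iff_left (pow_ne_zero 3 (by exact_mod_cast hmq))] at hzero
  have hvertex : ∀ i, 0 ≤ T i i i - f xstar := by
    intro i
    have hmem := single_mem_stdSimplex ℝ i
    have h := hT' _ hmem
    simp only [Pi.single_apply, mul_ite, mul_one, mul_zero, Finset.sum_ite_eq',
      Finset.mem_univ, if_true] at h
    rw [h]
    exact sub_nonneg.mpr (hmin _ hmem)
  have hpair : ∀ i j, (T i i i - f xstar) + (T j j j - f xstar) +
      ((T i i j - f xstar) + (T i j i - f xstar) + (T j i i - f xstar)) +
      ((T j j i - f xstar) + (T j i j - f xstar) + (T i j j - f xstar)) ≤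
      8 * (simplexMax n f - f xstar) := by
    intro i j
    have hmem := (count_div_mem_gridSet two_ne_zero ![i, j] (S := univ) (by simp)).1
    have h := trilinear_count_div ![i, j] univ (2 : ℕ) (fun i j k => T i j k - f xstar) _
      (fun _ => rfl)
    rw [hT' _ hmem] at h
    have hle := hle_max _ hmem
    simp only [Fin.sum_univ_two, Matrix.cons_val_zero, Matrix.cons_val_one] at h
    push_cast at h hle
    linarith
  obtain ⟨S, hS, hSle⟩ := exists_powersetCard_sum_triple_le (ι := Fin (m * q)) (r := r) (m := m)
    (by omega) (by rw [Fintype.card_fin]; nlinarith) (by simpa using hq1) (by simpa using hq2)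
    (fun a b d => T (c a) (c b) (c d) - f xstar) (simplexMax n f - f xstar)
    (fun a => hvertex _) (fun a b => hpair _ _) hzero
  have hmem := count_div_mem_gridSet (by omega) c (Finset.mem_powersetCard.mp hS).2
  have h := trilinear_count_div c S r (fun i j k => T i j k - f xstar) _ (fun _ => rfl)
  rw [hT' _ hmem.1] at h
  have hr0 : (0 : ℝ) < r := by exact_mod_cast (by omega : 0 < r)
  rw [hsmin]
  calc gridMin n r f - f xstar ≤ _ := sub_le_sub_right (hgrid_le _ hmem) _
    _ = _ := h
    _ ≤ 6 * m * r * (simplexMax n f - f xstar) / (r : ℝ) ^ 3 := by gcongr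
    _ = _ := by field_simp
end

section
/- Let d ≥ 1, let β ∈ I(n,d), let r, m be integers with 1 ≤ r ≤ m and m ≥ d, and let m_1, …, m_n be nonnegative integers with Σ_{i=1}^n m_i = m. Define the rational number A_β := r^{\underline{d}} (∏_{i=1}^n m_i^{\underline{β_i}} − ∏_{i=1}^n m_i^{β_i}) + Σ_{α ∈ ℕ^n, α ≤ β, α ≠ β} (r^{\underline{|α|}} m^{\underline{d}} / m^{\underline{|α|}}) ∏_{i=1}^n m_i^{\underline{α_i}} S(β_i, α_i). Then A_β ≥ 0. -/
open Finset

/-- Stirling numbers of the second kind: `stirling2 a b` counts the partitions of a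
set of `a` objects into `b` nonempty subsets. -/
def stirling2 : ℕ → ℕ → ℕ
  | 0, 0 => 1
  | 0, _ + 1 => 0
  | _ + 1, 0 => 0
  | a + 1, b + 1 => (b + 1) * stirling2 a (b + 1) + stirling2 a b

theorem stirling2_eq_stirlingSecond : ∀ a b : ℕ, stirling2 a b = Nat.stirlingSecond a b
  | 0, 0 => rfl
  | 0, _ + 1 => rfl
  | _ + 1, 0 => rfl
  | a + 1, b + 1 => by
    rw [stirling2, Nat.stirlingSecond_succ_succ, stirling2_eq_stirlingSecond a (b + 1),
      stirling2_eq_stirlingSecond a b]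

theorem Nat.mul_descFactorial_eq_add (x k : ℕ) :
    x * x.descFactorial k = x.descFactorial (k + 1) + k * x.descFactorial k := by
  rcases le_or_gt k x with h | h
  · rw [Nat.descFactorial_succ, ← add_mul, Nat.sub_add_cancel h]
  · simp [Nat.descFactorial_eq_zero_iff_lt.2 h, Nat.descFactorial_succ]

theorem Nat.pow_eq_sum_descFactorial_mul_stirlingSecond (x n : ℕ) :
    x ^ n = ∑ k ∈ range (n + 1), x.descFactorial k * n.stirlingSecond k := by
  induction n with
  | zero => simp
  | succ n ih =>
    have hshift : ∑ k ∈ range (n + 1), (k + 1) * (x.descFactorial (k + 1) *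
        n.stirlingSecond (k + 1)) =
        ∑ k ∈ range (n + 1), k * (x.descFactorial k * n.stirlingSecond k) := by
      have h := sum_range_succ' (fun k ↦ k * (x.descFactorial k * n.stirlingSecond k)) (n + 1)
      rw [sum_range_succ, Nat.stirlingSecond_eq_zero_of_lt (Nat.lt_succ_self n)] at h
      simpa using h.symm
    rw [sum_range_succ', Nat.stirlingSecond_succ_zero, mul_zero, add_zero, pow_succ', ih, mul_sum]
    calc ∑ k ∈ range (n + 1), x * (x.descFactorial k * n.stirlingSecond k)
        = ∑ k ∈ range (n + 1), x.descFactorial (k + 1) * n.stirlingSecond k +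
          ∑ k ∈ range (n + 1), k * (x.descFactorial k * n.stirlingSecond k) := by
          rw [← sum_add_distrib]
          refine sum_congr rfl fun k _ ↦ ?_
          rw [← mul_assoc, Nat.mul_descFactorial_eq_add]
          ring
      _ = _ := by
          rw [← hshift, ← sum_add_distrib]
          refine sum_congr rfl fun k _ ↦ ?_
          rw [Nat.stirlingSecond_succ_succ]
          ring

theorem prod_pow_eq_sum_Iic_stirling2 {n : ℕ} (x β : Fin n → ℕ) :
    ∏ i, x i ^ β i =
      ∑ α ∈ Iic β, (∏ i, (x i).descFactorial (α i)) * ∏ i, stirling2 (β i) (α i) := by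
  have hIic : Iic β = Fintype.piFinset fun i ↦ range (β i + 1) := by
    ext α
    simp [Pi.le_def]
  simp_rw [Nat.pow_eq_sum_descFactorial_mul_stirlingSecond, prod_univ_sum, hIic,
    prod_mul_distrib, stirling2_eq_stirlingSecond]

theorem Nat.descFactorial_mul_descFactorial_le {r m k d : ℕ} (hrm : r ≤ m) (hkd : k ≤ d) :
    r.descFactorial d * m.descFactorial k ≤ r.descFactorial k * m.descFactorial d := by
  rw [← Nat.descFactorial_mul_descFactorial (n := r) hkd,
    ← Nat.descFactorial_mul_descFactorial (n := m) hkd]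
  have h : (r - k).descFactorial (d - k) ≤ (m - k).descFactorial (d - k) :=
    Nat.descFactorial_le _ (Nat.sub_le_sub_right hrm k)
  calc _ = r.descFactorial k * m.descFactorial k * (r - k).descFactorial (d - k) := by ring
    _ ≤ r.descFactorial k * m.descFactorial k * (m - k).descFactorial (d - k) :=
      Nat.mul_le_mul_left _ h
    _ = _ := by ring

/-- Lemma 4.5, inequality (4.3): the quantity `A_β` is nonnegative. -/
theorem A_beta_nonneg (n d : ℕ) (hd : 1 ≤ d) (β : Fin n → ℕ) (hβ : ∑ i, β i = d)
    (r m : ℕ) (hr : 1 ≤ r) (hrm : r ≤ m) (hm : d ≤ m)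
    (mvec : Fin n → ℕ) (hmvec : ∑ i, mvec i = m) :
    0 ≤ (r.descFactorial d : ℝ) *
          ((∏ i, ((mvec i).descFactorial (β i) : ℝ)) - ∏ i, ((mvec i : ℝ)) ^ β i) +
        ∑ α ∈ Finset.Iic β \ {β},
          (r.descFactorial (∑ i, α i) : ℝ) * (m.descFactorial d : ℝ) /
              (m.descFactorial (∑ i, α i) : ℝ) *
            (∏ i, ((mvec i).descFactorial (α i) : ℝ)) *
            ∏ i, (stirling2 (β i) (α i) : ℝ) := by
  have hpow : ∏ i, (mvec i : ℝ) ^ β i = ∑ α ∈ Iic β \ {β},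
      (∏ i, ((mvec i).descFactorial (α i) : ℝ)) * (∏ i, (stirling2 (β i) (α i) : ℝ)) +
      ∏ i, ((mvec i).descFactorial (β i) : ℝ) := by
    have h := congrArg (Nat.cast (R := ℝ)) (prod_pow_eq_sum_Iic_stirling2 mvec β)
    rw [← sum_sdiff (singleton_subset_iff.2 (mem_Iic.2 le_rfl)), sum_singleton] at h
    simpa [stirling2_eq_stirlingSecond, Nat.stirlingSecond_self] using h
  rw [hpow, sub_add_cancel_right, mul_neg, neg_add_eq_sub, sub_nonneg, mul_sum]
  refine sum_le_sum fun α hα ↦ ?_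
  have hle : ∑ i, α i ≤ d :=
    hβ ▸ sum_le_sum fun i _ ↦ mem_Iic.1 (mem_sdiff.1 hα).1 i
  have hpos : (0 : ℝ) < m.descFactorial (∑ i, α i) := by
    exact_mod_cast Nat.descFactorial_pos.2 (hle.trans hm)
  rw [mul_assoc (_ / _)]
  refine mul_le_mul_of_nonneg_right ?_ (by positivity)
  rw [le_div_iff₀ hpos]
  exact_mod_cast Nat.descFactorial_mul_descFactorial_le hrm hle
end

section
/- Let d ≥ 1, let r, m be integers with 1 ≤ r ≤ m and m ≥ d, and let m_1, …, m_n be nonnegative integers with Σ_{i=1}^n m_i = m. For β ∈ I(n,d), define A_β := r^{\underline{d}} (∏_{i=1}^n m_i^{\underline{β_i}} − ∏_{i=1}^n m_i^{β_i}) + Σ_{α ∈ ℕ^n, α ≤ β, α ≠ β} (r^{\underline{|α|}} m^{\underline{d}} / m^{\underline{|α|}}) ∏_{i=1}^n m_i^{\underline{α_i}} S(β_i, α_i). Then Σ_{β ∈ I(n,d)} (d!/β!) A_β = r^d m^{\underline{d}} − r^{\underline{d}} m^d. -/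
open Finset

theorem stirling2_eq_zero_of_lt {a b : ℕ} (hab : a < b) : stirling2 a b = 0 := by
  induction a generalizing b with
  | zero => cases b <;> simp_all [stirling2]
  | succ a ih =>
    cases b with
    | zero => omega
    | succ b => simp [stirling2, ih (show a < b + 1 by omega), ih (show a < b by omega)]

/-- Normal ordering of powers: `x ^ a` in the basis of falling factorials. -/
theorem pow_eq_sum_descFactorial_mul_stirling2 (x a : ℕ) :
    x ^ a = ∑ i ∈ Iic a, x.descFactorial i * stirling2 a i := by
  have hIic : Iic a = range (a + 1) := by
    ext i
    simp
  rw [hIic]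
  clear hIic
  induction a with
  | zero => simp [stirling2]
  | succ a ih =>
    have hstep : ∀ i, x.descFactorial i * x =
        x.descFactorial i * i + x.descFactorial (i + 1) := by
      intro i
      rw [Nat.descFactorial_succ]
      rcases le_or_gt i x with h | h
      · obtain ⟨y, rfl⟩ := Nat.exists_eq_add_of_le h
        rw [Nat.add_sub_cancel_left]; ring
      · simp [Nat.descFactorial_eq_zero_iff_lt.2 h]
    have hshift := sum_range_succ (fun i ↦ x.descFactorial i * i * stirling2 a i) (a + 1)
    rw [stirling2_eq_zero_of_lt a.lt_succ_self, sum_range_succ'] at hshift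
    rw [pow_succ, ih, sum_mul, sum_range_succ' _ (a + 1)]
    have hexp : ∀ i, x.descFactorial (i + 1) * stirling2 (a + 1) (i + 1) =
        x.descFactorial (i + 1) * (i + 1) * stirling2 a (i + 1) +
          x.descFactorial (i + 1) * stirling2 a i := by
      intro i; simp only [stirling2]; ring
    have hmul : ∀ i, x.descFactorial i * stirling2 a i * x =
        x.descFactorial i * i * stirling2 a i + x.descFactorial (i + 1) * stirling2 a i := by
      intro i; rw [mul_right_comm, hstep]; ring
    simp only [hexp, hmul, sum_add_distrib]
    simp only [stirling2]
    omega

theorem stirling2_self (a : ℕ) : stirling2 a a = 1 := by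
  induction a with
  | zero => simp [stirling2]
  | succ a ih => simp [stirling2, ih, stirling2_eq_zero_of_lt]

theorem choose_mul_descFactorial (m x a : ℕ) :
    m.choose x * x.descFactorial a =
      m.descFactorial a * if a ≤ x then (m - a).choose (x - a) else 0 := by
  split_ifs with h
  · rw [Nat.descFactorial_eq_factorial_mul_choose, Nat.descFactorial_eq_factorial_mul_choose,
      mul_left_comm, Nat.choose_mul h, mul_assoc]
  · simp [Nat.descFactorial_eq_zero_iff_lt.2 (not_le.1 h)]

/-- Factorial moments of the multivariate hypergeometric distribution. -/
theorem sum_finsuppAntidiag_prod_choose_mul_descFactorial {n : ℕ} (r : ℕ) (v α : Fin n → ℕ) :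
    (∑ i, v i).descFactorial (∑ i, α i) *
        ∑ x ∈ finsuppAntidiag univ r, ∏ i, (v i).choose (x i) * (x i).descFactorial (α i) =
      (∏ i, (v i).descFactorial (α i)) *
        ((∑ i, v i).choose r * r.descFactorial (∑ i, α i)) := by
  by_cases h : ∀ i, α i ≤ v i
  · have hcoeff : ∀ a b k : ℕ, PowerSeries.coeff k
        ((Polynomial.X ^ a * (1 + Polynomial.X) ^ b : Polynomial ℕ) : PowerSeries ℕ) =
          if a ≤ k then b.choose (k - a) else 0 := by
      intro a b k
      rw [Polynomial.coeff_coe, Polynomial.coeff_X_pow_mul', Polynomial.coeff_one_add_X_pow]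
      simp
    have hprod := PowerSeries.coeff_prod (fun i ↦
      ((Polynomial.X ^ α i * (1 + Polynomial.X) ^ (v i - α i) : Polynomial ℕ) :
        PowerSeries ℕ)) r univ
    have hpoly : (∏ i, ((Polynomial.X ^ α i * (1 + Polynomial.X) ^ (v i - α i) :
        Polynomial ℕ) : PowerSeries ℕ)) = ((Polynomial.X ^ (∑ i, α i) *
          (1 + Polynomial.X) ^ (∑ i, v i - ∑ i, α i) : Polynomial ℕ) : PowerSeries ℕ) := by
      rw [← sum_tsub_distrib _ fun i _ ↦ h i, ← prod_pow_eq_pow_sum, ← prod_pow_eq_pow_sum,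
        ← prod_mul_distrib]
      exact (map_prod (Polynomial.coeToPowerSeries.ringHom (R := ℕ)) _ _).symm
    rw [hpoly] at hprod
    simp only [hcoeff] at hprod
    simp only [choose_mul_descFactorial, prod_mul_distrib, ← mul_sum]
    rw [hprod]
    ring
  · push Not at h
    obtain ⟨i, hi⟩ := h
    have hz : (v i).descFactorial (α i) = 0 := Nat.descFactorial_eq_zero_iff_lt.2 hi
    have hx : ∀ x : Fin n →₀ ℕ, ∏ i, (v i).choose (x i) * (x i).descFactorial (α i) = 0 := by
      intro x
      refine prod_eq_zero (mem_univ i) ?_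
      rw [choose_mul_descFactorial, hz, zero_mul]
    rw [prod_eq_zero (mem_univ i) hz]
    simp [hx]

/-- Mixed moments of the multivariate hypergeometric distribution. -/
theorem sum_Iic_stirling2_eq_sum_finsuppAntidiag {n : ℕ} (r : ℕ) (v β : Fin n → ℕ)
    (hβ : ∑ i, β i ≤ ∑ i, v i) :
    ((∑ i, v i).choose r : ℝ) * ∑ α ∈ Iic β, (r.descFactorial (∑ i, α i) : ℝ) /
        ((∑ i, v i).descFactorial (∑ i, α i) : ℝ) *
        (∏ i, ((v i).descFactorial (α i) : ℝ)) * ∏ i, (stirling2 (β i) (α i) : ℝ) =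
      ∑ x ∈ finsuppAntidiag univ r, (∏ i, ((v i).choose (x i) : ℝ)) * ∏ i, (x i : ℝ) ^ β i := by
  have hIic : Iic β = Fintype.piFinset fun i ↦ Iic (β i) := by
    ext α
    simp [Pi.le_def]
  have hpow : ∀ x : Fin n →₀ ℕ, ∏ i, (x i : ℝ) ^ β i =
      ∑ α ∈ Iic β, ∏ i, ((x i).descFactorial (α i) * stirling2 (β i) (α i) : ℝ) := by
    intro x
    rw [hIic, ← prod_univ_sum (fun i ↦ Iic (β i))
      fun i j ↦ ((x i).descFactorial j * stirling2 (β i) j : ℝ)]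
    exact prod_congr rfl fun i _ ↦ mod_cast pow_eq_sum_descFactorial_mul_stirling2 (x i) (β i)
  simp only [hpow, mul_sum]
  rw [sum_comm]
  refine sum_congr rfl fun α hα ↦ ?_
  have hα' : ∑ i, α i ≤ ∑ i, v i := (sum_le_sum fun i _ ↦ mem_Iic.1 hα i).trans hβ
  have hne : ((∑ i, v i).descFactorial (∑ i, α i) : ℝ) ≠ 0 :=
    Nat.cast_ne_zero.2 fun h0 ↦ (Nat.descFactorial_eq_zero_iff_lt.1 h0).not_ge hα'
  have hmom : ((∑ i, v i).descFactorial (∑ i, α i) : ℝ) *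
        ∑ x ∈ finsuppAntidiag univ r, ∏ i, ((v i).choose (x i) * (x i).descFactorial (α i) : ℝ) =
      (∏ i, ((v i).descFactorial (α i) : ℝ)) *
        ((∑ i, v i).choose r * r.descFactorial (∑ i, α i)) :=
    mod_cast sum_finsuppAntidiag_prod_choose_mul_descFactorial r v α
  simp only [prod_mul_distrib, ← mul_assoc, ← sum_mul] at hmom ⊢
  congr 1
  field_simp
  linear_combination -hmom

theorem sum_antidiagonalTuple_factorial_div_mul_prod_pow {n : ℕ} (d : ℕ) (x : Fin n → ℝ) :
    ∑ β ∈ Finset.Nat.antidiagonalTuple n d,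
        (d.factorial : ℝ) / (∏ i, ((β i).factorial : ℝ)) * ∏ i, x i ^ β i = (∑ i, x i) ^ d := by
  rw [sum_pow_eq_sum_piAntidiag, piAntidiag_univ_fin_eq_antidiagonalTuple]
  refine sum_congr rfl fun β hβ ↦ ?_
  congr 1
  rw [Finset.Nat.mem_antidiagonalTuple] at hβ
  have hspec : (∏ i, ((β i).factorial : ℝ)) * (Nat.multinomial univ β : ℝ) = d.factorial := by
    rw [← hβ]
    exact mod_cast Nat.multinomial_spec univ β
  rw [div_eq_iff (prod_ne_zero_iff.2 fun i _ ↦ Nat.cast_ne_zero.2 (β i).factorial_ne_zero),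
    ← hspec, mul_comm]

/-- Lemma 4.5, identity (4.4): `Σ_{β ∈ I(n,d)} (d!/β!) A_β = r^d m^{\underline d} − r^{\underline d} m^d`. -/
theorem sum_A_beta (n d : ℕ) (hd : 1 ≤ d)
    (r m : ℕ) (hr : 1 ≤ r) (hrm : r ≤ m) (hm : d ≤ m)
    (mvec : Fin n → ℕ) (hmvec : ∑ i, mvec i = m) :
    ∑ β ∈ Finset.Nat.antidiagonalTuple n d,
        (d.factorial : ℝ) / (∏ i, ((β i).factorial : ℝ)) *
          ((r.descFactorial d : ℝ) *
              ((∏ i, ((mvec i).descFactorial (β i) : ℝ)) - ∏ i, ((mvec i : ℝ)) ^ β i) +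
            ∑ α ∈ Finset.Iic β \ {β},
              (r.descFactorial (∑ i, α i) : ℝ) * (m.descFactorial d : ℝ) /
                  (m.descFactorial (∑ i, α i) : ℝ) *
                (∏ i, ((mvec i).descFactorial (α i) : ℝ)) *
                ∏ i, (stirling2 (β i) (α i) : ℝ))
      = (r : ℝ) ^ d * (m.descFactorial d : ℝ) -
          (r.descFactorial d : ℝ) * (m : ℝ) ^ d := by
  subst hmvec
  set m := ∑ i, mvec i with hmdef
  have hC : (m.choose r : ℝ) ≠ 0 := Nat.cast_ne_zero.2 (Nat.choose_pos hrm).ne'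
  have hA : ∀ β ∈ Finset.Nat.antidiagonalTuple n d,
      (r.descFactorial d : ℝ) *
              ((∏ i, ((mvec i).descFactorial (β i) : ℝ)) - ∏ i, ((mvec i : ℝ)) ^ β i) +
            ∑ α ∈ Finset.Iic β \ {β},
              (r.descFactorial (∑ i, α i) : ℝ) * (m.descFactorial d : ℝ) /
                  (m.descFactorial (∑ i, α i) : ℝ) *
                (∏ i, ((mvec i).descFactorial (α i) : ℝ)) *
                ∏ i, (stirling2 (β i) (α i) : ℝ) =
        (m.descFactorial d : ℝ) / (m.choose r : ℝ) * (∑ x ∈ finsuppAntidiag univ r,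
          (∏ i, ((mvec i).choose (x i) : ℝ)) * ∏ i, (x i : ℝ) ^ β i) -
        (r.descFactorial d : ℝ) * ∏ i, (mvec i : ℝ) ^ β i := by
    intro β hβ
    rw [Finset.Nat.mem_antidiagonalTuple] at hβ
    have hne : (m.descFactorial d : ℝ) ≠ 0 :=
      Nat.cast_ne_zero.2 fun h0 ↦ (Nat.descFactorial_eq_zero_iff_lt.1 h0).not_ge hm
    rw [← sum_Iic_stirling2_eq_sum_finsuppAntidiag r mvec β (hβ.trans_le hm), ← hmdef,
      ← mul_assoc, div_mul_cancel₀ _ hC, mul_sum,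
      ← sum_sdiff (singleton_subset_iff.2 (mem_Iic.2 (le_refl β))), sum_singleton, hβ]
    simp only [stirling2_self, Nat.cast_one, prod_const_one, mul_one]
    rw [← mul_assoc (m.descFactorial d : ℝ), mul_div_cancel₀ _ hne]
    rw [sum_congr rfl fun α _ ↦ show (r.descFactorial (∑ i, α i) : ℝ) * (m.descFactorial d : ℝ) /
        (m.descFactorial (∑ i, α i) : ℝ) * (∏ i, ((mvec i).descFactorial (α i) : ℝ)) *
          ∏ i, (stirling2 (β i) (α i) : ℝ) = (m.descFactorial d : ℝ) *
        ((r.descFactorial (∑ i, α i) : ℝ) / (m.descFactorial (∑ i, α i) : ℝ) *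
          (∏ i, ((mvec i).descFactorial (α i) : ℝ)) * ∏ i, (stirling2 (β i) (α i) : ℝ)) by ring]
    ring
  have htotal : ∑ x ∈ finsuppAntidiag univ r, (∏ i, ((mvec i).choose (x i) : ℝ)) =
      m.choose r := by
    have h0 := sum_finsuppAntidiag_prod_choose_mul_descFactorial r mvec fun _ ↦ 0
    simp only [sum_const_zero, Nat.descFactorial_zero, one_mul, mul_one, prod_const_one] at h0
    exact mod_cast h0
  have hmixed : ∑ β ∈ Finset.Nat.antidiagonalTuple n d,
      (d.factorial : ℝ) / (∏ i, ((β i).factorial : ℝ)) * (∑ x ∈ finsuppAntidiag univ r,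
          (∏ i, ((mvec i).choose (x i) : ℝ)) * ∏ i, (x i : ℝ) ^ β i) =
      m.choose r * (r : ℝ) ^ d := by
    simp only [mul_sum]
    rw [sum_comm, ← htotal, sum_mul]
    refine sum_congr rfl fun x hx ↦ ?_
    have hsum : (r : ℝ) = ∑ i, (x i : ℝ) := mod_cast (mem_finsuppAntidiag.1 hx).1.symm
    rw [hsum, ← sum_antidiagonalTuple_factorial_div_mul_prod_pow, mul_sum]
    exact sum_congr rfl fun β _ ↦ by ring
  have hpow := sum_antidiagonalTuple_factorial_div_mul_prod_pow d fun i ↦ (mvec i : ℝ)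
  rw [← Nat.cast_sum, ← hmdef] at hpow
  rw [sum_congr rfl fun β hβ ↦ by rw [hA β hβ]]
  simp only [mul_sub, sum_sub_distrib, mul_left_comm _ ((m.descFactorial d : ℝ) / _),
    mul_left_comm _ (r.descFactorial d : ℝ), ← mul_sum]
  rw [hmixed, hpow]
  field_simp
end

section
/- Let d ≥ 1 and let r, m, k be integers with m ≥ d, k ≥ 1, r ≥ 1 and (k−1)m < r ≤ km. Then 1 − (r^{\underline{d}} (km)^d)/(r^d (km)^{\underline{d}}) ≤ (m/r²) · (d−1)(d! − 1). -/
/-- One factor of the ratio of falling factorials of `r` and `N`, bounded from below. -/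
theorem one_sub_factor_le {d r m N i : ℕ} (hdN : d ≤ N) (hdr : d ≤ r) (hrN : r ≤ N)
    (hNr : N ≤ r + m) (hi : i < d) :
    1 - ((r : ℝ) - i) * N / (r * ((N : ℝ) - i)) ≤ i * (m * ((d : ℝ) - 1) / (r : ℝ) ^ 2) := by
  have hi' : (i : ℝ) + 1 ≤ d := by exact_mod_cast hi
  have hdN' : (d : ℝ) ≤ N := by exact_mod_cast hdN
  have hdr' : (d : ℝ) ≤ r := by exact_mod_cast hdr
  have hNr' : (N : ℝ) ≤ r + m := by exact_mod_cast hNr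
  have hrN' : (r : ℝ) ≤ N := by exact_mod_cast hrN
  have hi0 : (0 : ℝ) ≤ i := i.cast_nonneg
  have hm0 : (0 : ℝ) ≤ m := m.cast_nonneg
  have hr0 : (0 : ℝ) < r := by linarith
  have hNi : (0 : ℝ) < N - i := by linarith
  rcases i.eq_zero_or_pos with rfl | hipos
  · have hN0 : (0 : ℝ) < N := by linarith
    have : (r : ℝ) * N ≠ 0 := by positivity
    simp [div_self this]
  have h2d : (2 : ℝ) ≤ d := by exact_mod_cast (show 2 ≤ d by omega)
  have hgap : ((N : ℝ) - r) * r ≤ m * ((N : ℝ) - 1) := by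
    rcases hrN.eq_or_lt with h | h
    · rw [h, sub_self, zero_mul]
      exact mul_nonneg hm0 (by linarith)
    · have h' : (r : ℝ) + 1 ≤ N := by exact_mod_cast h
      exact mul_le_mul (by linarith) (by linarith) hr0.le hm0
  have hden : (N : ℝ) - 1 ≤ ((d : ℝ) - 1) * (N - i) := by
    nlinarith [mul_nonneg (sub_nonneg.2 h2d) (sub_nonneg.2 hdN'),
      mul_nonneg (sub_nonneg.2 h2d) (sub_nonneg.2 hi')]
  have heq : 1 - ((r : ℝ) - i) * N / (r * ((N : ℝ) - i)) =
      i * ((N - r) * r / ((r : ℝ) ^ 2 * (N - i))) := by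
    field_simp
    ring
  rw [heq]
  refine mul_le_mul_of_nonneg_left ?_ hi0
  rw [div_le_div_iff₀ (by positivity) (by positivity)]
  have : ((N : ℝ) - r) * r ≤ m * (((d : ℝ) - 1) * (N - i)) :=
    hgap.trans (mul_le_mul_of_nonneg_left hden hm0)
  nlinarith [mul_le_mul_of_nonneg_right this (sq_nonneg (r : ℝ))]

theorem one_sub_descFactorial_ratio_le {d r m N : ℕ} (hdN : d ≤ N) (hdr : d ≤ r) (hrN : r ≤ N)
    (hNr : N ≤ r + m) {j : ℕ} (hj : j ≤ d) :
    0 ≤ (r.descFactorial j : ℝ) * (N : ℝ) ^ j / ((r : ℝ) ^ j * N.descFactorial j) ∧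
    (r.descFactorial j : ℝ) * (N : ℝ) ^ j / ((r : ℝ) ^ j * N.descFactorial j) ≤ 1 ∧
    1 - (r.descFactorial j : ℝ) * (N : ℝ) ^ j / ((r : ℝ) ^ j * N.descFactorial j) ≤
      (j * ((j : ℝ) - 1) / 2) * (m * ((d : ℝ) - 1) / (r : ℝ) ^ 2) := by
  induction j with
  | zero => simp
  | succ j ih =>
    obtain ⟨h0, h1, h2⟩ := ih (by omega)
    have hf := one_sub_factor_le hdN hdr hrN hNr (show j < d by omega)
    have hjr : (j : ℝ) + 1 ≤ r := by exact_mod_cast hj.trans hdr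
    have hrN' : (r : ℝ) ≤ N := by exact_mod_cast hrN
    have hj0 : (0 : ℝ) ≤ j := j.cast_nonneg
    have hr0 : (0 : ℝ) < r := by linarith
    have hNj : (0 : ℝ) < N - j := by linarith
    have hf0 : 0 ≤ ((r : ℝ) - j) * N / (r * ((N : ℝ) - j)) :=
      div_nonneg (mul_nonneg (by linarith) (by linarith)) (by positivity)
    have hf1 : ((r : ℝ) - j) * N / (r * ((N : ℝ) - j)) ≤ 1 := by
      rw [div_le_one (by positivity)]
      nlinarith
    have hP : (r.descFactorial (j + 1) : ℝ) * (N : ℝ) ^ (j + 1) /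
          ((r : ℝ) ^ (j + 1) * N.descFactorial (j + 1)) =
        (r.descFactorial j : ℝ) * (N : ℝ) ^ j / ((r : ℝ) ^ j * N.descFactorial j) *
          (((r : ℝ) - j) * N / (r * ((N : ℝ) - j))) := by
      rw [Nat.descFactorial_succ, Nat.descFactorial_succ, Nat.cast_mul, Nat.cast_mul,
        Nat.cast_sub (by omega), Nat.cast_sub (by omega), div_mul_div_comm]
      congr 1 <;> ring
    rw [hP]
    generalize (r.descFactorial j : ℝ) * (N : ℝ) ^ j / ((r : ℝ) ^ j * N.descFactorial j) = P at *
    generalize ((r : ℝ) - j) * N / (r * ((N : ℝ) - j)) = f at *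
    refine ⟨mul_nonneg h0 hf0, mul_le_one₀ h1 hf0 hf1, ?_⟩
    push_cast
    nlinarith [mul_nonneg (sub_nonneg.2 h1) (sub_nonneg.2 hf1)]

theorem mul_pred_div_two_le_factorial_sub_one {d : ℕ} (hd : 1 ≤ d) :
    (d : ℝ) * ((d : ℝ) - 1) / 2 ≤ (d.factorial : ℝ) - 1 := by
  induction d, hd using Nat.le_induction with
  | base => simp
  | succ n hn ih =>
    have hn' : (1 : ℝ) ≤ n := by exact_mod_cast hn
    have hfac : (1 : ℝ) ≤ n.factorial := by exact_mod_cast n.factorial_pos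
    rw [Nat.factorial_succ]
    push_cast
    nlinarith

/-- Lemma 4.7: for integers `m ≥ d ≥ 1`, `k ≥ 1`, `r ≥ 1` with `(k−1)m < r ≤ km`,
one has `1 − r^{\underline d}(km)^d/(r^d (km)^{\underline d}) ≤ (m/r²)·(d−1)(d!−1)`. -/
theorem one_sub_ratio_le (d r m k : ℕ) (hd : 1 ≤ d) (hm : d ≤ m) (hk : 1 ≤ k)
    (hr : 1 ≤ r) (h1 : (k - 1) * m < r) (h2 : r ≤ k * m) :
    1 - (r.descFactorial d : ℝ) * ((k * m : ℕ) : ℝ) ^ d /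
          ((r : ℝ) ^ d * (((k * m : ℕ).descFactorial d : ℕ) : ℝ)) ≤
      (m : ℝ) / (r : ℝ) ^ 2 * (((d : ℝ) - 1) * ((d.factorial : ℝ) - 1)) := by
  have hd' : (1 : ℝ) ≤ d := by exact_mod_cast hd
  have hr0 : (0 : ℝ) < r := by exact_mod_cast hr
  have hfac := mul_pred_div_two_le_factorial_sub_one hd
  rcases Nat.lt_or_ge r d with hrd | hdr
  · have hrd' : (r : ℝ) + 1 ≤ d := by exact_mod_cast hrd
    have hm' : (d : ℝ) ≤ m := by exact_mod_cast hm
    have hfac1 : (1 : ℝ) ≤ (d.factorial : ℝ) - 1 := by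
      have h2d : 2 ≤ d := by omega
      have : (2 : ℝ) ≤ d.factorial := by exact_mod_cast h2d.trans d.self_le_factorial
      linarith
    rw [Nat.descFactorial_eq_zero_iff_lt.2 hrd, Nat.cast_zero, zero_mul, zero_div, sub_zero,
      div_mul_eq_mul_div, one_le_div (by positivity)]
    calc (r : ℝ) ^ 2 = r * (r * 1) := by ring
      _ ≤ m * (((d : ℝ) - 1) * ((d.factorial : ℝ) - 1)) := by
        gcongr
        · linarith
        · linarith
  · have hmN : m ≤ k * m := Nat.le_mul_of_pos_left m hk
    have hNr : k * m ≤ r + m := by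
      obtain ⟨n, rfl⟩ : ∃ n, k = n + 1 := ⟨k - 1, by omega⟩
      rw [Nat.add_sub_cancel] at h1
      rw [Nat.succ_mul]
      omega
    have hC : 0 ≤ (m : ℝ) * ((d : ℝ) - 1) / (r : ℝ) ^ 2 :=
      div_nonneg (mul_nonneg m.cast_nonneg (by linarith)) (by positivity)
    refine (one_sub_descFactorial_ratio_le (hm.trans hmN) hdr h2 hNr le_rfl).2.2.trans ?_
    refine (mul_le_mul_of_nonneg_right hfac hC).trans_eq ?_
    ring
end

section
/- Let f ∈ H_{n,d} be an n-variate homogeneous polynomial of degree d ≥ 1 with a global minimizer x* over Δ_n satisfying x* ∈ Δ(n,m) for some integer m ≥ d. Then for every integer r ≥ d, f_{Δ(n,r)} − \underline{f} ≤ (m/r²) · (d−1)(d! − 1) · C(2d−1, d) · d^d · (\overline{f} − \underline{f}), where C(2d−1, d) is the binomial coefficient. -/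
open Finset

theorem sum_signed_superset_range {ι : Type*} [Fintype ι] [DecidableEq ι] (j : ι → ι) :
    ∑ S : Finset ι, (-1 : ℝ) ^ (#Sᶜ) * (if ∀ k, j k ∈ S then 1 else 0) =
      if Function.Bijective j then 1 else 0 := by
  classical
  have h := Finset.prod_add (fun _ : ι => (1 : ℝ))
    (fun i => if i ∈ Set.range j then (0 : ℝ) else -1) univ
  have hl : ∏ i : ι, ((1 : ℝ) + if i ∈ Set.range j then (0 : ℝ) else -1) =
      if Function.Bijective j then 1 else 0 := by
    split_ifs with hj <;> rw [← Finite.surjective_iff_bijective] at hj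
    · refine Finset.prod_eq_one fun i _ => ?_
      simp [Set.mem_range.2 (hj i)]
    · obtain ⟨i, hi⟩ := not_forall.1 hj
      refine Finset.prod_eq_zero (mem_univ i) ?_
      rw [if_neg (by simpa using hi)]
      norm_num
  rw [← hl, h, Finset.powerset_univ]
  refine Finset.sum_congr rfl fun S _ => ?_
  rw [Finset.prod_const_one, one_mul, ← Finset.compl_eq_univ_sdiff]
  split_ifs with hS
  · rw [mul_one, ← Finset.prod_const]
    refine Finset.prod_congr rfl fun i hi => ?_
    rw [if_neg]
    rintro ⟨k, rfl⟩
    exact Finset.mem_compl.1 hi (hS k)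
  · obtain ⟨k, hk⟩ := not_forall.1 hS
    rw [mul_zero, Finset.prod_eq_zero (Finset.mem_compl.2 hk)]
    simp

/-- The polarization identity for a multilinear map. -/
theorem MultilinearMap.sum_perm_eq_signed_sum {ι E : Type*} [Fintype ι] [DecidableEq ι]
    [AddCommGroup E] [Module ℝ E] (F : MultilinearMap ℝ (fun _ : ι => E) ℝ) (v : ι → E) :
    ∑ σ : Equiv.Perm ι, F (fun k => v (σ k)) =
      ∑ S : Finset ι, (-1 : ℝ) ^ (#Sᶜ) * F (fun _ => ∑ s ∈ S, v s) := by
  classical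
  have h1 : ∀ S : Finset ι, F (fun _ => ∑ s ∈ S, v s) =
      ∑ j : ι → ι, (if ∀ k, j k ∈ S then 1 else 0) * F (fun k => v (j k)) := by
    intro S
    rw [F.map_sum_finset (fun _ s => v s) (fun _ => S)]
    simp_rw [ite_mul, one_mul, zero_mul]
    rw [← Finset.sum_filter]
    refine Finset.sum_congr ?_ fun _ _ => rfl
    ext j
    simp
  simp_rw [h1, Finset.mul_sum]
  rw [Finset.sum_comm]
  simp_rw [← mul_assoc, ← Finset.sum_mul, sum_signed_superset_range, ite_mul, one_mul, zero_mul]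
  rw [← Finset.sum_filter]
  refine Finset.sum_bij (fun σ _ => ⇑σ) (fun σ _ => by simp)
    (fun σ _ τ _ h => DFunLike.coe_injective h) (fun j hj => ?_) fun _ _ => rfl
  exact ⟨Equiv.ofBijective j (by simpa using hj), mem_univ _, rfl⟩

theorem MultilinearMap.map_const_smul {ι E : Type*} [Fintype ι] [AddCommGroup E] [Module ℝ E]
    (F : MultilinearMap ℝ (fun _ : ι => E) ℝ) (c : ℝ) (x : E) :
    F (fun _ => c • x) = c ^ Fintype.card ι * F (fun _ => x) := by
  rw [F.map_smul_univ (fun _ => c) (fun _ => x)]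
  simp

theorem inv_card_smul_sum_mem {κ E : Type*} [AddCommGroup E] [Module ℝ E] {K : Set E}
    (hK : Convex ℝ K) {S : Finset κ} (hS : S.Nonempty) {v : κ → E} (hv : ∀ s ∈ S, v s ∈ K) :
    (#S : ℝ)⁻¹ • ∑ s ∈ S, v s ∈ K := by
  have hpos : (0 : ℝ) < #S := by exact_mod_cast hS.card_pos
  rw [Finset.smul_sum]
  refine hK.sum_mem (fun _ _ => by positivity) ?_ hv
  simp [hpos.ne']

/-- A multilinear map, averaged over the permutations of its arguments, is bounded on a convex
set in terms of its values on the diagonal. -/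
theorem MultilinearMap.abs_sum_perm_le {ι E : Type*} [Fintype ι] [DecidableEq ι] [Nonempty ι]
    [AddCommGroup E] [Module ℝ E] (F : MultilinearMap ℝ (fun _ : ι => E) ℝ) {K : Set E}
    (hK : Convex ℝ K) {B : ℝ} (hB : 0 ≤ B) (hF : ∀ x ∈ K, |F (fun _ => x)| ≤ B)
    {v : ι → E} (hv : ∀ k, v k ∈ K) :
    |∑ σ : Equiv.Perm ι, F (fun k => v (σ k))| ≤
      2 ^ Fintype.card ι * (Fintype.card ι : ℝ) ^ Fintype.card ι * B := by
  rw [F.sum_perm_eq_signed_sum]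
  refine (Finset.abs_sum_le_sum_abs _ _).trans ?_
  have hterm : ∀ S : Finset ι, |(-1 : ℝ) ^ (#Sᶜ) * F (fun _ => ∑ s ∈ S, v s)| ≤
      (Fintype.card ι : ℝ) ^ Fintype.card ι * B := by
    intro S
    rw [abs_mul, abs_pow, abs_neg, abs_one, one_pow, one_mul]
    rcases S.eq_empty_or_nonempty with rfl | hS
    · rw [Finset.sum_empty, F.map_coord_zero (Classical.arbitrary ι) rfl, abs_zero]
      positivity
    · have hpos : (0 : ℝ) < #S := by exact_mod_cast hS.card_pos
      have hx := hF _ (inv_card_smul_sum_mem hK hS fun s _ => hv s)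
      have he : ∑ s ∈ S, v s = (#S : ℝ) • ((#S : ℝ)⁻¹ • ∑ s ∈ S, v s) := by
        rw [smul_smul, mul_inv_cancel₀ hpos.ne', one_smul]
      rw [he, F.map_const_smul, abs_mul, abs_pow, Nat.abs_cast]
      have hle : (#S : ℝ) ≤ Fintype.card ι := by exact_mod_cast S.card_le_univ
      exact mul_le_mul (pow_le_pow_left₀ hpos.le hle _) hx (abs_nonneg _) (by positivity)
  refine (Finset.sum_le_sum fun S _ => hterm S).trans ?_
  simp [mul_assoc]

theorem sum_piFinset_const_succ {α : Type*} (d : ℕ) (R : Finset α)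
    (Ψ : (Fin (d + 1) → α) → ℝ) :
    ∑ j ∈ Fintype.piFinset (fun _ : Fin (d + 1) => R), Ψ j =
      ∑ j ∈ Fintype.piFinset (fun _ : Fin d => R), ∑ t ∈ R, Ψ (Fin.snoc j t) := by
  classical
  rw [← Finset.sum_product']
  refine Finset.sum_bij' (fun j _ => (Fin.init j, j (Fin.last d)))
    (fun a _ => Fin.snoc a.1 a.2) ?_ ?_ ?_ ?_ ?_
  · intro j hj
    rw [Fintype.mem_piFinset] at hj
    exact Finset.mem_product.2 ⟨Fintype.mem_piFinset.2 fun i => hj i.castSucc, hj (Fin.last d)⟩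
  · rintro ⟨j, t⟩ h
    have h' := Finset.mem_product.1 h
    rw [Fintype.mem_piFinset] at h' ⊢
    intro k
    refine Fin.lastCases ?_ (fun i => ?_) k
    · simpa only [Fin.snoc_last] using h'.2
    · simpa only [Fin.snoc_castSucc] using h'.1 i
  · exact fun j _ => Fin.snoc_init_self j
  · rintro ⟨j, t⟩ _
    simp only [Fin.init_snoc, Fin.snoc_last]
  · exact fun j _ => congrArg Ψ (Fin.snoc_init_self j).symm

/-- Changing the population from which one element is drawn changes the mean by little, if the
observable is constant off a small set contained in both populations. -/
theorem abs_mean_sub_mean_le {α : Type*} [Fintype α] [DecidableEq α] {R I : Finset α}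
    (hR : R.Nonempty) (hI : I ⊆ R) {B : ℝ} {g : α → ℝ} (hg : ∀ t, |g t| ≤ B)
    (hconst : ∀ s ∉ I, ∀ t ∉ I, g s = g t) :
    |(∑ t ∈ R, g t) / #R - (∑ t, g t) / Fintype.card α| ≤
      2 * #I * B * (1 / #R - 1 / Fintype.card α) := by
  have hRpos : (0 : ℝ) < #R := by exact_mod_cast hR.card_pos
  have hRle : (#R : ℝ) ≤ Fintype.card α := by exact_mod_cast R.card_le_univ
  have hdiff : (0 : ℝ) ≤ 1 / #R - 1 / Fintype.card α :=
    sub_nonneg.2 (one_div_le_one_div_of_le hRpos hRle)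
  obtain ⟨c, hcB, hc⟩ : ∃ c : ℝ, |c| ≤ B ∧ ∀ t ∉ I, g t = c := by
    by_cases h : ∃ s, s ∉ I
    · obtain ⟨s, hs⟩ := h
      exact ⟨g s, hg s, fun t ht => hconst t ht s hs⟩
    · push Not at h
      obtain ⟨a, -⟩ := hR
      exact ⟨g a, hg a, fun t ht => absurd (h t) ht⟩
  have key : ∀ S : Finset α, I ⊆ S → ∑ t ∈ S, g t = ∑ t ∈ I, (g t - c) + #S * c := by
    intro S hS
    have h0 : ∑ t ∈ I, (g t - c) = ∑ t ∈ S, (g t - c) :=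
      Finset.sum_subset hS fun t _ ht => by rw [hc t ht, sub_self]
    rw [h0, Finset.sum_sub_distrib]
    simp
  have hsum : |∑ t ∈ I, (g t - c)| ≤ 2 * #I * B := by
    refine (Finset.abs_sum_le_sum_abs _ _).trans ?_
    refine (Finset.sum_le_sum (g := fun _ => 2 * B) fun t _ => ?_).trans (le_of_eq ?_)
    · exact (abs_sub _ _).trans (by linarith [hg t])
    · rw [Finset.sum_const, nsmul_eq_mul]
      ring
  rw [key R hI, key univ (Finset.subset_univ I), Finset.card_univ]
  have hMpos : (0 : ℝ) < Fintype.card α := hRpos.trans_le hRle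
  have he : (∑ t ∈ I, (g t - c) + #R * c) / #R -
      (∑ t ∈ I, (g t - c) + Fintype.card α * c) / Fintype.card α =
      (∑ t ∈ I, (g t - c)) * (1 / #R - 1 / Fintype.card α) := by
    field_simp
    ring
  rw [he, abs_mul, abs_of_nonneg hdiff]
  gcongr

/-- For an observable of `d`-tuples that is invariant under relabelling, sampling with replacement
from a subpopulation and from the whole population give nearly the same mean. -/
theorem abs_mean_tuple_sub_mean_tuple_le {α : Type*} [Fintype α] [DecidableEq α] {R : Finset α}
    (hR : R.Nonempty) {B : ℝ} (d : ℕ) (Ψ : (Fin d → α) → ℝ)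
    (hinv : ∀ (σ : Equiv.Perm α) (j : Fin d → α), Ψ (fun k => σ (j k)) = Ψ j)
    (hΨ : ∀ j, |Ψ j| ≤ B) :
    |(∑ j ∈ Fintype.piFinset (fun _ : Fin d => R), Ψ j) / (#R : ℝ) ^ d -
        (∑ j, Ψ j) / (Fintype.card α : ℝ) ^ d| ≤
      d * ((d : ℝ) - 1) * B * (1 / #R - 1 / Fintype.card α) := by
  induction d with
  | zero =>
    simp
  | succ d ih =>
    have hRpos : (0 : ℝ) < #R := by exact_mod_cast hR.card_pos
    have hRle : (#R : ℝ) ≤ Fintype.card α := by exact_mod_cast R.card_le_univ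
    have hMpos : (0 : ℝ) < Fintype.card α := hRpos.trans_le hRle
    have hdiff : (0 : ℝ) ≤ 1 / #R - 1 / Fintype.card α :=
      sub_nonneg.2 (one_div_le_one_div_of_le hRpos hRle)
    have hB : 0 ≤ B := by
      obtain ⟨a, -⟩ := hR
      exact (abs_nonneg _).trans (hΨ fun _ => a)
    have hsnoc : ∀ (σ : Equiv.Perm α) (j : Fin d → α) (t : α),
        Ψ (Fin.snoc (fun k => σ (j k)) (σ t)) = Ψ (Fin.snoc j t) := by
      intro σ j t
      rw [← hinv σ (Fin.snoc j t)]
      congr 1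
      ext k
      refine Fin.lastCases ?_ (fun i => ?_) k <;> simp
    have ih' := ih (fun j => (∑ t, Ψ (Fin.snoc j t)) / Fintype.card α)
      (fun σ j => by
        congr 1
        rw [← Equiv.sum_comp σ]
        exact Finset.sum_congr rfl fun t _ => hsnoc σ j t)
      (fun j => by
        rw [abs_div, Nat.abs_cast, div_le_iff₀ hMpos]
        refine (Finset.abs_sum_le_sum_abs _ _).trans
          ((Finset.sum_le_sum fun t _ => hΨ _).trans (le_of_eq ?_))
        rw [Finset.sum_const, nsmul_eq_mul, Finset.card_univ, mul_comm])
    have hstep : ∀ j ∈ Fintype.piFinset (fun _ : Fin d => R),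
        |(∑ t ∈ R, Ψ (Fin.snoc j t)) / #R - (∑ t, Ψ (Fin.snoc j t)) / Fintype.card α| ≤
          2 * d * B * (1 / #R - 1 / Fintype.card α) := by
      intro j hj
      rw [Fintype.mem_piFinset] at hj
      have hI : univ.image j ⊆ R := by
        intro a ha
        obtain ⟨k, -, rfl⟩ := Finset.mem_image.1 ha
        exact hj k
      have hcard : (#(univ.image j) : ℝ) ≤ d := by
        exact_mod_cast Finset.card_image_le.trans (by simp)
      refine (abs_mean_sub_mean_le hR hI (fun t => hΨ (Fin.snoc j t)) ?_).trans ?_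
      · intro s hs t ht
        simp only [mem_image, mem_univ, true_and, not_exists] at hs ht
        rw [← hsnoc (Equiv.swap s t) j s, Equiv.swap_apply_left]
        congr 2
        funext k
        exact Equiv.swap_apply_of_ne_of_ne (hs k) (ht k)
      · gcongr
    have huniv : ∑ j, Ψ j = ∑ j : Fin d → α, ∑ t, Ψ (Fin.snoc j t) := by
      have h := sum_piFinset_const_succ d univ Ψ
      simpa only [Fintype.piFinset_univ] using h
    have h1 : |(∑ j ∈ Fintype.piFinset (fun _ : Fin (d + 1) => R), Ψ j) / (#R : ℝ) ^ (d + 1) -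
        (∑ j ∈ Fintype.piFinset (fun _ : Fin d => R),
          (∑ t, Ψ (Fin.snoc j t)) / Fintype.card α) / (#R : ℝ) ^ d| ≤
        2 * d * B * (1 / #R - 1 / Fintype.card α) := by
      rw [sum_piFinset_const_succ, pow_succ', ← div_div, ← sub_div, Finset.sum_div,
        ← Finset.sum_sub_distrib, abs_div, abs_of_pos (pow_pos hRpos d),
        div_le_iff₀ (pow_pos hRpos d)]
      refine (Finset.abs_sum_le_sum_abs _ _).trans
        ((Finset.sum_le_sum hstep).trans (le_of_eq ?_))
      rw [Finset.sum_const, nsmul_eq_mul, Fintype.card_piFinset_const]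
      push_cast
      ring
    have h2 : (∑ j : Fin d → α, (∑ t, Ψ (Fin.snoc j t)) / Fintype.card α) /
        (Fintype.card α : ℝ) ^ d = (∑ j, Ψ j) / (Fintype.card α : ℝ) ^ (d + 1) := by
      rw [huniv, ← Finset.sum_div, div_div, pow_succ']
    rw [h2] at ih'
    refine (abs_sub_le _ _ _).trans ((add_le_add h1 ih').trans (le_of_eq ?_))
    push_cast
    ring

theorem MultilinearMap.sum_piFinset_eq {d : ℕ} {E α : Type*} [AddCommGroup E] [Module ℝ E]
    (G : MultilinearMap ℝ (fun _ : Fin d => E) ℝ) (R : Finset α) (w : α → E) :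
    (∑ j ∈ Fintype.piFinset (fun _ : Fin d => R), G (fun k => w (j k))) / (#R : ℝ) ^ d =
      G (fun _ => (#R : ℝ)⁻¹ • ∑ a ∈ R, w a) := by
  rw [G.map_const_smul, Fintype.card_fin, G.map_sum_finset (fun _ a => w a) (fun _ => R),
    inv_pow, div_eq_inv_mul]

/-- Among the samples without replacement from a finite population of points, some sample mean has
diagonal value not much larger than that of the population mean. -/
theorem MultilinearMap.exists_perm_mean_le {d : ℕ} (hd : 0 < d) {E α : Type*} [AddCommGroup E]
    [Module ℝ E] [Fintype α] [DecidableEq α] (F : MultilinearMap ℝ (fun _ : Fin d => E) ℝ)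
    {K : Set E} (hK : Convex ℝ K) {B : ℝ} (hB : 0 ≤ B) (hF : ∀ x ∈ K, |F (fun _ => x)| ≤ B)
    {R : Finset α} (hR : R.Nonempty) {v : α → E} (hv : ∀ a, v a ∈ K) :
    ∃ σ : Equiv.Perm α,
      F (fun _ => (#R : ℝ)⁻¹ • ∑ a ∈ R, v (σ a)) -
          F (fun _ => (Fintype.card α : ℝ)⁻¹ • ∑ a, v a) ≤
        d * ((d : ℝ) - 1) * (2 ^ d * (d : ℝ) ^ d / d.factorial * B) *
          (1 / #R - 1 / Fintype.card α) := by
  have : Nonempty (Fin d) := ⟨⟨0, hd⟩⟩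
  have hfac : (0 : ℝ) < d.factorial := by exact_mod_cast d.factorial_pos
  let G : MultilinearMap ℝ (fun _ : Fin d => E) ℝ :=
    ∑ π : Equiv.Perm (Fin d), F.domDomCongr π
  have hG : ∀ w, G w = ∑ π : Equiv.Perm (Fin d), F (fun k => w (π k)) := by
    intro w
    simp [G]
  have hGdiag : ∀ x, G (fun _ => x) = d.factorial * F (fun _ => x) := by
    intro x
    rw [hG, Finset.sum_const, Finset.card_univ, Fintype.card_perm, Fintype.card_fin, nsmul_eq_mul]
  let Ψ : (Fin d → α) → ℝ := fun j => ∑ σ : Equiv.Perm α, G (fun k => v (σ (j k)))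
  have hΨ : ∀ j, |Ψ j| ≤ Fintype.card (Equiv.Perm α) * (2 ^ d * (d : ℝ) ^ d * B) := by
    intro j
    refine (Finset.abs_sum_le_sum_abs _ _).trans
      ((Finset.sum_le_sum (g := fun _ => 2 ^ d * (d : ℝ) ^ d * B) fun σ _ => ?_).trans
        (le_of_eq ?_))
    · have h := F.abs_sum_perm_le hK hB hF (v := fun k => v (σ (j k))) fun k => hv _
      rw [hG]
      simpa only [Fintype.card_fin] using h
    · rw [Finset.sum_const, nsmul_eq_mul, Finset.card_univ]
  have hinv : ∀ (τ : Equiv.Perm α) (j : Fin d → α), Ψ (fun k => τ (j k)) = Ψ j := by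
    intro τ j
    exact Equiv.sum_comp (Equiv.mulRight τ)
      (fun σ : Equiv.Perm α => G (fun k => v (σ (j k))))
  have hmean : ∀ S : Finset α, S.Nonempty →
      (∑ j ∈ Fintype.piFinset (fun _ : Fin d => S), Ψ j) / (#S : ℝ) ^ d =
        d.factorial * ∑ σ : Equiv.Perm α, F (fun _ => (#S : ℝ)⁻¹ • ∑ a ∈ S, v (σ a)) := by
    intro S hS
    rw [Finset.sum_comm, Finset.sum_div, Finset.mul_sum]
    refine Finset.sum_congr rfl fun σ _ => ?_
    rw [G.sum_piFinset_eq S (fun a => v (σ a)), hGdiag]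
  have hmain := abs_mean_tuple_sub_mean_tuple_le hR d Ψ hinv hΨ
  have huniv := hmean univ (hR.mono (Finset.subset_univ R))
  rw [Fintype.piFinset_univ, Finset.card_univ] at huniv
  rw [hmean R hR, huniv] at hmain
  have hσ : ∀ σ : Equiv.Perm α, ∑ a, v (σ a) = ∑ a, v a := fun σ => Equiv.sum_comp σ v
  simp_rw [hσ] at hmain
  set N : ℝ := (Fintype.card (Equiv.Perm α) : ℝ) with hN
  have hle := (le_abs_self _).trans hmain
  obtain ⟨σ, -, h⟩ := Finset.exists_le_of_sum_le (s := (univ : Finset (Equiv.Perm α)))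
    (f := fun σ => F (fun _ => (#R : ℝ)⁻¹ • ∑ a ∈ R, v (σ a)))
    (g := fun _ => F (fun _ => (Fintype.card α : ℝ)⁻¹ • ∑ a, v a) +
      d * ((d : ℝ) - 1) * (2 ^ d * (d : ℝ) ^ d / d.factorial * B) *
          (1 / #R - 1 / Fintype.card α)) univ_nonempty (by
      rw [Finset.sum_add_distrib, Finset.sum_const (b := _ * _), nsmul_eq_mul, Finset.card_univ,
        ← hN, ← sub_le_iff_le_add']
      rw [← mul_sub] at hle
      refine le_of_mul_le_mul_left (hle.trans (le_of_eq ?_)) hfac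
      field_simp)
  exact ⟨σ, by linarith⟩

/-- A homogeneous polynomial is the restriction to the diagonal of a multilinear map. -/
theorem MvPolynomial.IsHomogeneous.exists_multilinearMap {n d : ℕ} {p : MvPolynomial (Fin n) ℝ}
    (hp : p.IsHomogeneous d) :
    ∃ F : MultilinearMap ℝ (fun _ : Fin d => Fin n → ℝ) ℝ,
      ∀ x, F (fun _ => x) = MvPolynomial.eval x p := by
  have hmon : ∀ β ∈ p.support, ∃ τ : Fin d → Fin n,
      ∀ x : Fin n → ℝ, ∏ k, x (τ k) = β.prod fun i e => x i ^ e := by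
    intro β hβ
    have hlen : β.toMultiset.toList.length = d := by
      rw [Multiset.length_toList, Finsupp.card_toMultiset]
      exact (hp.degree_eq_sum_deg_support hβ).symm
    subst hlen
    refine ⟨β.toMultiset.toList.get, fun x => ?_⟩
    have h := Finsupp.prod_toMultiset (β.mapDomain x)
    rw [← Finsupp.toMultiset_map, Finsupp.prod_mapDomain_index (by simp) (by
      intro b m₁ m₂
      exact pow_add b m₁ m₂)] at h
    rw [← h, ← Multiset.prod_toList, ← List.prod_ofFn]
    conv_rhs => rw [← Multiset.coe_toList β.toMultiset]
    rw [Multiset.map_coe, Multiset.prod_toList, Multiset.prod_coe]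
    congr 1
    conv_rhs => rw [← List.ofFn_get β.toMultiset.toList, List.map_ofFn]
    rfl
  choose τ hτ using hmon
  refine ⟨∑ β ∈ p.support.attach, p.coeff β.1 •
    (MultilinearMap.mkPiAlgebra ℝ (Fin d) ℝ).compLinearMap
      (fun k => LinearMap.proj (τ β.1 β.2 k)), fun x => ?_⟩
  rw [MvPolynomial.eval_eq', _root_.sum_apply, ← Finset.sum_attach p.support]
  refine Finset.sum_congr rfl fun β _ => ?_
  have h := hτ β.1 β.2 x
  rw [Finsupp.prod_fintype _ _ (by simp)] at h
  simp [h]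

/-- A point of the grid with denominator `M` is approximated by grid points of denominator
`r ≤ M`, with an error governed by the size of the polynomial on the simplex. -/
theorem exists_mem_gridSet_eval_sub_le {n d : ℕ} (hd : 0 < d) {p : MvPolynomial (Fin n) ℝ}
    (hp : p.IsHomogeneous d) {B : ℝ} (hB : ∀ x ∈ stdSimplex ℝ (Fin n), |MvPolynomial.eval x p| ≤ B)
    {r M : ℕ} (hr : 0 < r) (hrM : r ≤ M) {x : Fin n → ℝ} (hx : x ∈ gridSet n M) :
    ∃ y ∈ gridSet n r, MvPolynomial.eval y p - MvPolynomial.eval x p ≤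
      d * ((d : ℝ) - 1) * (2 ^ d * (d : ℝ) ^ d / d.factorial * B) * (1 / r - 1 / M) := by
  obtain ⟨F, hF⟩ := hp.exists_multilinearMap
  obtain ⟨hxs, hxk⟩ := hx
  choose k hk using hxk
  have hMpos : (0 : ℝ) < M := by exact_mod_cast hr.trans_le hrM
  have hrpos : (0 : ℝ) < r := by exact_mod_cast hr
  have hcard : Fintype.card (Σ i, Fin (k i)) = M := by
    have h : ((∑ i, k i : ℕ) : ℝ) = M := by
      push_cast
      simp_rw [← hk]
      rw [← Finset.mul_sum, hxs.2, mul_one]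
    simpa using (by exact_mod_cast h : ∑ i, k i = M)
  obtain ⟨R, -, hRcard⟩ := Finset.exists_subset_card_eq
    (s := (univ : Finset (Σ i, Fin (k i)))) (n := r) (by rwa [Finset.card_univ, hcard])
  have hR : R.Nonempty := Finset.card_pos.1 (hRcard ▸ hr)
  have hv : ∀ a : Σ i, Fin (k i), (Pi.single a.1 1 : Fin n → ℝ) ∈ stdSimplex ℝ (Fin n) :=
    fun a => single_mem_stdSimplex ℝ a.1
  obtain ⟨σ, hσ⟩ := F.exists_perm_mean_le hd (convex_stdSimplex ℝ (Fin n))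
    ((abs_nonneg _).trans (hB x hxs)) (fun y hy => by rw [hF]; exact hB y hy) hR hv
  have hxmean : (M : ℝ)⁻¹ • ∑ a : Σ i, Fin (k i), (Pi.single a.1 1 : Fin n → ℝ) = x := by
    funext i
    rw [Pi.smul_apply, Finset.sum_apply, Fintype.sum_sigma, smul_eq_mul,
      inv_mul_eq_iff_eq_mul₀ hMpos.ne', hk]
    simp [Pi.single_apply]
  rw [hcard, hRcard, hF, hF, hxmean] at hσ
  refine ⟨_, ⟨?_, fun i => ⟨#{a ∈ R | (σ a).1 = i}, ?_⟩⟩, hσ⟩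
  · rw [← hRcard]
    exact inv_card_smul_sum_mem (convex_stdSimplex ℝ (Fin n)) hR fun a _ => hv (σ a)
  · rw [Pi.smul_apply, smul_eq_mul, mul_inv_cancel_left₀ hrpos.ne', Finset.sum_apply]
    simp [Pi.single_apply, eq_comm]

theorem bddAbove_eval_stdSimplex {n : ℕ} (p : MvPolynomial (Fin n) ℝ) :
    BddAbove ((fun x => MvPolynomial.eval x p) '' stdSimplex ℝ (Fin n)) :=
  ((isCompact_stdSimplex ℝ (Fin n)).image (MvPolynomial.continuous_eval p)).bddAbove

theorem two_pow_le_two_mul_factorial (k : ℕ) : 2 ^ k ≤ 2 * k.factorial := by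
  induction k with
  | zero => simp
  | succ k ih =>
    rcases Nat.eq_zero_or_pos k with rfl | hk
    · simp
    · rw [pow_succ, Nat.factorial_succ]
      nlinarith [Nat.factorial_pos k]

theorem mul_two_pow_div_factorial_le {d : ℕ} (hd : 1 ≤ d) :
    (d : ℝ) * ((d : ℝ) - 1) * (2 ^ d / d.factorial) ≤
      2 * (((d : ℝ) - 1) * ((d.factorial : ℝ) - 1)) * ((2 * d - 1).choose d : ℝ) := by
  obtain ⟨k, rfl⟩ := Nat.exists_eq_add_of_le' hd
  rcases Nat.eq_zero_or_pos k with rfl | hk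
  · simp
  have hkpos : (0 : ℝ) < k := by exact_mod_cast hk
  have hfac : (0 : ℝ) < k.factorial := by exact_mod_cast k.factorial_pos
  have hleft : ((k + 1 : ℕ) : ℝ) * (2 ^ (k + 1) / (k + 1).factorial) ≤ 4 := by
    have h : (2 : ℝ) ^ k ≤ 2 * k.factorial := by exact_mod_cast two_pow_le_two_mul_factorial k
    rw [← mul_div_assoc, div_le_iff₀ (by exact_mod_cast (k + 1).factorial_pos),
      Nat.factorial_succ, pow_succ]
    push_cast
    nlinarith
  have hchoose : (2 : ℝ) ≤ (2 * (k + 1) - 1).choose (k + 1) := by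
    have h : (k + 2).choose (k + 1) ≤ (2 * (k + 1) - 1).choose (k + 1) :=
      Nat.choose_le_choose _ (by omega)
    rw [Nat.choose_succ_self_right] at h
    exact_mod_cast (by omega : 2 ≤ k + 1 + 1).trans h
  have hfac' : (1 : ℝ) ≤ (k + 1).factorial - 1 := by
    have h : 2 ≤ (k + 1).factorial := (by omega : 2 ≤ k + 1).trans (Nat.self_le_factorial _)
    have h' : (2 : ℝ) ≤ (k + 1).factorial := by exact_mod_cast h
    linarith
  have hprod : 4 ≤ 2 * (((k + 1).factorial : ℝ) - 1) * (2 * (k + 1) - 1).choose (k + 1) := by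
    nlinarith
  have hk1 : ((k + 1 : ℕ) : ℝ) - 1 = k := by push_cast; ring
  rw [hk1]
  calc ((k + 1 : ℕ) : ℝ) * k * (2 ^ (k + 1) / (k + 1).factorial)
      = k * (((k + 1 : ℕ) : ℝ) * (2 ^ (k + 1) / (k + 1).factorial)) := by ring
    _ ≤ k * (2 * (((k + 1).factorial : ℝ) - 1) * (2 * (k + 1) - 1).choose (k + 1)) := by
        exact mul_le_mul_of_nonneg_left (hleft.trans hprod) hkpos.le
    _ = _ := by ring

theorem gridSet_subset_gridSet_mul {n m : ℕ} (q : ℕ) : gridSet n m ⊆ gridSet n (q * m) := by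
  rintro x ⟨hx, hk⟩
  refine ⟨hx, fun i => ?_⟩
  obtain ⟨k, hk⟩ := hk i
  refine ⟨q * k, ?_⟩
  push_cast
  rw [mul_assoc, hk]

/-- Every `r` has a multiple `M` of `m` just above it, so that `1 / r - 1 / M ≤ m / r ^ 2`. -/
theorem exists_mul_ge_inv_sub_inv_le {m r : ℕ} (hm : 0 < m) (hr : 0 < r) :
    ∃ q : ℕ, r ≤ q * m ∧ (1 : ℝ) / r - 1 / (q * m : ℕ) ≤ m / (r : ℝ) ^ 2 := by
  have hdiv := Nat.div_add_mod r m
  have hmod := Nat.mod_lt r hm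
  have hge : r ≤ (r / m + 1) * m := by nlinarith
  refine ⟨r / m + 1, hge, ?_⟩
  have hub : (r / m + 1) * m ≤ r + m := by
    rw [add_mul, one_mul, mul_comm]
    omega
  generalize (r / m + 1) * m = M at hge hub
  have hrpos : (0 : ℝ) < r := by exact_mod_cast hr
  have hge' : (r : ℝ) ≤ M := by exact_mod_cast hge
  have hub' : (M : ℝ) ≤ r + m := by exact_mod_cast hub
  have hMpos : (0 : ℝ) < M := hrpos.trans_le hge'
  have hmnn : (0 : ℝ) ≤ m := m.cast_nonneg
  rw [div_sub_div _ _ hrpos.ne' hMpos.ne', div_le_div_iff₀ (by positivity) (by positivity)]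
  have h : ((M : ℝ) - r) * r ≤ m * M := by nlinarith
  nlinarith

/-- Corollary 4.6 (quantitative form): if a homogeneous polynomial `f` of degree `d ≥ 1`
has a global minimizer over the simplex lying in `Δ(n,m)` with `m ≥ d`, then for every
integer `r ≥ d`,
`f_{Δ(n,r)} − \underline f ≤ (m/r²)(d−1)(d!−1) C(2d−1,d) d^d (\overline f − \underline f)`. -/
theorem homogeneous_rational_minimizer_bound (n d : ℕ) (hd : 1 ≤ d)
    (p : MvPolynomial (Fin n) ℝ) (hp : p.IsHomogeneous d)
    (m : ℕ) (hm : d ≤ m) (xstar : Fin n → ℝ) (hxstar : xstar ∈ gridSet n m)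
    (hmin : ∀ x ∈ stdSimplex ℝ (Fin n),
      MvPolynomial.eval xstar p ≤ MvPolynomial.eval x p)
    (r : ℕ) (hr : d ≤ r) :
    gridMin n r (fun x => MvPolynomial.eval x p) -
        simplexMin n (fun x => MvPolynomial.eval x p) ≤
      (m : ℝ) / (r : ℝ) ^ 2 * (((d : ℝ) - 1) * ((d.factorial : ℝ) - 1)) *
        ((2 * d - 1).choose d : ℝ) * (d : ℝ) ^ d *
        (simplexMax n (fun x => MvPolynomial.eval x p) -
          simplexMin n (fun x => MvPolynomial.eval x p)) := by
  have hmineq : simplexMin n (fun x => MvPolynomial.eval x p) = MvPolynomial.eval xstar p :=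
    IsLeast.csInf_eq ⟨⟨xstar, hxstar.1, rfl⟩, by rintro _ ⟨x, hx, rfl⟩; exact hmin x hx⟩
  rw [hmineq]
  set a := MvPolynomial.eval xstar p with ha
  set b := simplexMax n (fun x => MvPolynomial.eval x p) with hb
  have hmax : ∀ x ∈ stdSimplex ℝ (Fin n), MvPolynomial.eval x p ≤ b := fun x hx =>
    le_csSup (bddAbove_eval_stdSimplex p) ⟨x, hx, rfl⟩
  have hab : a ≤ b := hmax xstar hxstar.1
  -- Centre the range of the polynomial on the simplex at `0`.
  let s : MvPolynomial (Fin n) ℝ := (∑ i, MvPolynomial.X i) ^ d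
  have hs : s.IsHomogeneous d := by
    have h := (MvPolynomial.IsHomogeneous.sum univ (fun i : Fin n => MvPolynomial.X (R := ℝ) i) 1
      fun i _ => MvPolynomial.isHomogeneous_X ℝ i).pow d
    rwa [one_mul] at h
  have hp' : (p - MvPolynomial.C ((a + b) / 2) * s).IsHomogeneous d := hp.sub (hs.C_mul _)
  have heval : ∀ x ∈ stdSimplex ℝ (Fin n),
      MvPolynomial.eval x (p - MvPolynomial.C ((a + b) / 2) * s) =
        MvPolynomial.eval x p - (a + b) / 2 := by
    intro x hx
    simp [s, hx.2]
  obtain ⟨q, hrq, hq⟩ := exists_mul_ge_inv_sub_inv_le (hd.trans hm) (hd.trans hr)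
  obtain ⟨y, hy, hyx⟩ := exists_mem_gridSet_eval_sub_le hd hp' (B := (b - a) / 2)
    (fun x hx => by
      rw [heval x hx, abs_le]
      constructor <;> linarith [hmin x hx, hmax x hx])
    (hd.trans hr) hrq (gridSet_subset_gridSet_mul q hxstar)
  rw [heval y hy.1, heval xstar hxstar.1, ← ha] at hyx
  have hgrid : gridMin n r (fun x => MvPolynomial.eval x p) ≤ MvPolynomial.eval y p :=
    csInf_le ⟨a, by rintro _ ⟨x, hx, rfl⟩; exact hmin x hx.1⟩ ⟨y, hy, rfl⟩
  have hd1 : (1 : ℝ) ≤ d := by exact_mod_cast hd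
  have hcoef : (0 : ℝ) ≤ d * ((d : ℝ) - 1) * (2 ^ d / d.factorial) :=
    mul_nonneg (mul_nonneg (by positivity) (by linarith)) (by positivity)
  have hw : 0 ≤ (d : ℝ) ^ d * ((b - a) / 2) := mul_nonneg (by positivity) (by linarith)
  calc gridMin n r (fun x => MvPolynomial.eval x p) - a
      ≤ d * ((d : ℝ) - 1) * (2 ^ d * (d : ℝ) ^ d / d.factorial * ((b - a) / 2)) *
          (1 / r - 1 / (q * m : ℕ)) := by linarith
    _ = d * ((d : ℝ) - 1) * (2 ^ d / d.factorial) * ((d : ℝ) ^ d * ((b - a) / 2)) *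
          (1 / r - 1 / (q * m : ℕ)) := by ring
    _ ≤ d * ((d : ℝ) - 1) * (2 ^ d / d.factorial) * ((d : ℝ) ^ d * ((b - a) / 2)) *
          (m / (r : ℝ) ^ 2) := mul_le_mul_of_nonneg_left hq (mul_nonneg hcoef hw)
    _ ≤ 2 * (((d : ℝ) - 1) * ((d.factorial : ℝ) - 1)) * ((2 * d - 1).choose d : ℝ) *
          ((d : ℝ) ^ d * ((b - a) / 2)) * (m / (r : ℝ) ^ 2) :=
        mul_le_mul_of_nonneg_right
          (mul_le_mul_of_nonneg_right (mul_two_pow_div_factorial_le hd) hw) (by positivity)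
    _ = _ := by ring
end

section
/- Let n ≥ 1, let k, d be integers with d > k ≥ 0, and let α ∈ I(n,k). Then S(d,k) = (α!/k!) · Σ_{β ∈ I(n,d)} (d!/β!) ∏_{i=1}^n S(β_i, α_i). -/
open Finset

open PowerSeries in
theorem PowerSeries.coeff_prod_antidiagonalTuple {R : Type*} [CommSemiring R] {n : ℕ}
    (f : Fin n → PowerSeries R) (d : ℕ) :
    coeff d (∏ i, f i) = ∑ β ∈ Finset.Nat.antidiagonalTuple n d, ∏ i, coeff (β i) (f i) := by
  rw [PowerSeries.coeff_prod]
  refine Finset.sum_equiv Finsupp.equivFunOnFinite (fun β => ?_) (fun β _ => ?_)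
  · simp [Finset.mem_finsuppAntidiag, Finset.Nat.mem_antidiagonalTuple]
  · simp

open PowerSeries in
/-- The exponential generating function of `k ! * stirling2 m k` is `(exp - 1) ^ k`. -/
theorem coeff_exp_sub_one_pow (m k : ℕ) :
    coeff m ((exp ℝ - 1) ^ k) = (k.factorial : ℝ) * stirling2 m k / m.factorial := by
  induction m generalizing k with
  | zero => cases k <;> simp [stirling2]
  | succ m ih =>
    cases k with
    | zero => simp [stirling2, coeff_one]
    | succ k =>
      have hderiv : d⁄dX ℝ ((exp ℝ - 1) ^ (k + 1)) =
          ((k + 1 : ℕ) : PowerSeries ℝ) * ((exp ℝ - 1) ^ (k + 1) + (exp ℝ - 1) ^ k) := by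
        rw [Derivation.leibniz_pow, map_sub, derivative_exp, Derivation.map_one_eq_zero,
          sub_zero, add_tsub_cancel_right, smul_eq_mul, nsmul_eq_mul]
        ring
      have hcoeff := congrArg (coeff m) hderiv
      rw [coeff_derivative, ← nsmul_eq_mul, map_nsmul, map_add, ih, ih, nsmul_eq_mul] at hcoeff
      have hm : (m : ℝ) + 1 ≠ 0 := by positivity
      rw [eq_div_of_mul_eq hm hcoeff]
      simp only [stirling2, Nat.factorial_succ]
      push_cast
      field_simp

/-- Lemma 4.4: given `α ∈ I(n,k)` and `d > k`, one has
`S(d,k) = (α!/k!) Σ_{β ∈ I(n,d)} (d!/β!) ∏ᵢ S(βᵢ,αᵢ)`. -/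
theorem stirling2_multinomial (n k d : ℕ) (hn : 1 ≤ n) (hkd : k < d)
    (α : Fin n → ℕ) (hα : ∑ i, α i = k) :
    (stirling2 d k : ℝ) =
      (∏ i, ((α i).factorial : ℝ)) / (k.factorial : ℝ) *
        ∑ β ∈ Finset.Nat.antidiagonalTuple n d,
          (d.factorial : ℝ) / (∏ i, ((β i).factorial : ℝ)) *
            ∏ i, (stirling2 (β i) (α i) : ℝ) := by
  have key := PowerSeries.coeff_prod_antidiagonalTuple
    (fun i => (PowerSeries.exp ℝ - 1) ^ α i) d
  rw [Finset.prod_pow_eq_pow_sum, hα, coeff_exp_sub_one_pow] at key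
  simp only [coeff_exp_sub_one_pow, Finset.prod_div_distrib, Finset.prod_mul_distrib] at key
  have hk : (k.factorial : ℝ) ≠ 0 := by positivity
  have hd : (d.factorial : ℝ) ≠ 0 := by positivity
  rw [div_eq_iff hd] at key
  rw [div_mul_eq_mul_div, eq_div_iff hk, mul_comm, key, Finset.sum_mul, Finset.mul_sum]
  exact Finset.sum_congr rfl fun β _ => by ring
end

section
/- Let m ≥ 3 be an integer and let r be an integer with 1 + (m−1)/(√(2m) − 1) ≤ r ≤ m. Then ((m−r)(4mr−2m−2r))/(r²(m−1)(m−2)) ≤ 4/r − 4/r². -/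
/-- Appendix B, first claim: for integers `m ≥ 3` and `r` with
`1 + (m−1)/(√(2m) − 1) ≤ r ≤ m`, one has
`((m−r)(4mr−2m−2r))/(r²(m−1)(m−2)) ≤ 4/r − 4/r²`. -/
theorem cubic_bound_implies_kls_small_r (m r : ℕ) (hm : 3 ≤ m)
    (hlow : 1 + ((m : ℝ) - 1) / (Real.sqrt (2 * (m : ℝ)) - 1) ≤ (r : ℝ))
    (hup : r ≤ m) :
    ((m : ℝ) - r) * (4 * (m : ℝ) * r - 2 * m - 2 * r) /
        ((r : ℝ) ^ 2 * ((m : ℝ) - 1) * ((m : ℝ) - 2)) ≤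
      4 / (r : ℝ) - 4 / (r : ℝ) ^ 2 := by
  have hm' : (3 : ℝ) ≤ m := by exact_mod_cast hm
  have hs : Real.sqrt (2 * (m : ℝ)) ^ 2 = 2 * m := Real.sq_sqrt (by positivity)
  have hs1 : 1 < Real.sqrt (2 * (m : ℝ)) := Real.lt_sqrt_of_sq_lt (by linarith)
  set s := Real.sqrt (2 * (m : ℝ))
  have hdiv : ((m : ℝ) - 1) / (s - 1) ≤ (r : ℝ) - 1 := by linarith
  have hr : (1 : ℝ) < r := by
    have : 0 < ((m : ℝ) - 1) / (s - 1) := div_pos (by linarith) (by linarith)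
    linarith
  rw [div_le_iff₀ (by linarith)] at hdiv
  have hsq : ((m : ℝ) + r - 2) ^ 2 ≤ ((r - 1) * s) ^ 2 :=
    pow_le_pow_left₀ (by linarith) (by linarith) 2
  rw [mul_pow, hs] at hsq
  have hr0 : (r : ℝ) ≠ 0 := by linarith
  have hrhs : 4 / (r : ℝ) - 4 / (r : ℝ) ^ 2 = 4 * (r - 1) / (r : ℝ) ^ 2 := by
    field_simp
  have h1 : (0 : ℝ) < m - 1 := by linarith
  have h2 : (0 : ℝ) < m - 2 := by linarith
  rw [hrhs, div_le_div_iff₀ (by positivity) (by positivity)]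
  have key : ((m : ℝ) - r) * (4 * m * r - 2 * m - 2 * r) ≤
      4 * (r - 1) * ((m - 1) * (m - 2)) := by
    linarith
  calc _ ≤ 4 * ((r : ℝ) - 1) * ((m - 1) * (m - 2)) * (r : ℝ) ^ 2 := by gcongr
    _ = _ := by ring
end

section
/- Let f = Σ_{I ⊆ {1,…,n}, |I| = d} f_I ∏_{i ∈ I} x_i be a square-free homogeneous polynomial of degree d, let m_1, …, m_n be nonnegative integers with Σ_{i=1}^n m_i = m, and let r be an integer with d ≤ r ≤ m. Then the hypergeometric expectation of f is given exactly by: Σ_{α ∈ I(n,r)} f(α/r) · (∏_{i=1}^n C(m_i, α_i)) / C(m, r) = (r^{\underline{d}} m^d)/(r^d m^{\underline{d}}) · f(m_1/m, …, m_n/m). -/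
open Finset

/-- Extracting a coefficient of a finite product of polynomials. -/
theorem Polynomial.sum_antidiagonalTuple_prod_coeff {R : Type*} [CommSemiring R] {n : ℕ}
    (P : Fin n → Polynomial R) (r : ℕ) :
    ∑ α ∈ Finset.Nat.antidiagonalTuple n r, ∏ i, (P i).coeff (α i) = (∏ i, P i).coeff r := by
  have h := PowerSeries.coeff_prod (fun i => (P i : PowerSeries R)) r univ
  have hcoe : ∏ i, (P i : PowerSeries R) = ((∏ i, P i : Polynomial R) : PowerSeries R) :=
    (map_prod Polynomial.coeToPowerSeries.ringHom P univ).symm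
  rw [hcoe, Polynomial.coeff_coe] at h
  rw [h]
  symm
  refine Finset.sum_equiv Finsupp.equivFunOnFinite (fun l => ?_) (fun l _ => ?_)
  · simp [Finset.mem_finsuppAntidiag, Finset.Nat.mem_antidiagonalTuple]
  · simp

/-- The polynomial whose coefficients are `k ^ s * C(m, k)`, for `s ≤ 1`. -/
theorem Polynomial.coeff_mul_X_pow_mul_one_add_X_pow (m s k : ℕ) (hs : s ≤ 1) :
    ((Polynomial.C (m : ℝ)) ^ s * (Polynomial.X ^ s * (1 + Polynomial.X) ^ (m - s))).coeff k =
      (k : ℝ) ^ s * (m.choose k : ℝ) := by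
  rw [← Polynomial.C_pow, Polynomial.coeff_C_mul]
  interval_cases s
  · simp [Polynomial.coeff_one_add_X_pow]
  · rcases k with _ | k
    · simp
    · rcases m with _ | m
      · simp
      · simp only [pow_one, Polynomial.coeff_X_mul, Polynomial.coeff_one_add_X_pow,
          Nat.add_sub_cancel]
        have := Nat.add_one_mul_choose_eq m k
        rw [mul_comm ((k + 1 : ℕ) : ℝ)]
        exact_mod_cast this

/-- Weighted Vandermonde identity: square-free moments of the hypergeometric weights. -/
theorem sum_antidiagonalTuple_prod_pow_mul_choose {n : ℕ} (s a : Fin n → ℕ)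
    (hs : ∀ i, s i ≤ 1) (r : ℕ) (hr : ∑ i, s i ≤ r) :
    ∑ α ∈ Finset.Nat.antidiagonalTuple n r,
        (∏ i, (α i : ℝ) ^ s i) * ∏ i, ((a i).choose (α i) : ℝ) =
      (∏ i, (a i : ℝ) ^ s i) * ((∑ i, a i - ∑ i, s i).choose (r - ∑ i, s i) : ℝ) := by
  have h := Polynomial.sum_antidiagonalTuple_prod_coeff (fun i =>
    (Polynomial.C (a i : ℝ)) ^ s i * (Polynomial.X ^ s i * (1 + Polynomial.X) ^ (a i - s i))) r
  simp only [Polynomial.coeff_mul_X_pow_mul_one_add_X_pow _ _ _ (hs _)] at h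
  simp only [← prod_mul_distrib]
  rw [h]
  simp only [prod_mul_distrib, prod_pow_eq_pow_sum, ← Polynomial.C_pow, ← map_prod,
    Polynomial.coeff_C_mul]
  by_cases hle : ∀ i, s i ≤ a i
  · rw [sum_tsub_distrib _ (fun i _ => hle i), Polynomial.coeff_X_pow_mul', if_pos hr,
      Polynomial.coeff_one_add_X_pow]
  · push Not at hle
    obtain ⟨i, hi⟩ := hle
    have h0 : ∏ i, (a i : ℝ) ^ s i = 0 := by
      refine prod_eq_zero (mem_univ i) ?_
      have := hs i
      have ha : a i = 0 := by omega
      rw [ha, Nat.cast_zero, zero_pow (by omega)]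
    rw [h0, zero_mul, zero_mul]

/-- Ratio of `C(m - d, r - d)` to `C(m, r)` in terms of falling factorials. -/
theorem Nat.choose_mul_descFactorial {m r d : ℕ} (hdr : d ≤ r) :
    m.choose r * r.descFactorial d = m.descFactorial d * (m - d).choose (r - d) := by
  rw [Nat.descFactorial_eq_factorial_mul_choose, Nat.descFactorial_eq_factorial_mul_choose,
    mul_left_comm, Nat.choose_mul hdr, mul_assoc]

/-- Appendix A (square-free case): for a square-free homogeneous polynomial `f` of
degree `d`, the hypergeometric expectation satisfies
`E[f(Y/r)] = (r^{\underline d} m^d)/(r^d m^{\underline d}) · f(m₁/m, …, mₙ/m)`,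
where `Pr[Y = α] = ∏ C(mᵢ,αᵢ)/C(m,r)` on `I(n,r)` and `d ≤ r ≤ m`. -/
theorem squarefree_hypergeometric_expectation (n d : ℕ)
    (p : MvPolynomial (Fin n) ℝ) (hp : p.IsHomogeneous d)
    (hsf : ∀ s ∈ p.support, ∀ i, s i ≤ 1)
    (mvec : Fin n → ℕ) (m : ℕ) (hmvec : ∑ i, mvec i = m)
    (r : ℕ) (hdr : d ≤ r) (hrm : r ≤ m) :
    ∑ α ∈ Finset.Nat.antidiagonalTuple n r,
        MvPolynomial.eval (fun i => (α i : ℝ) / (r : ℝ)) p *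
          ((∏ i, ((mvec i).choose (α i) : ℝ)) / (m.choose r : ℝ))
      = (r.descFactorial d : ℝ) * (m : ℝ) ^ d /
            ((r : ℝ) ^ d * (m.descFactorial d : ℝ)) *
          MvPolynomial.eval (fun i => (mvec i : ℝ) / (m : ℝ)) p := by
  simp only [MvPolynomial.eval_eq', sum_mul, mul_sum]
  rw [sum_comm]
  refine sum_congr rfl fun s hs => ?_
  have hsd : ∑ i, s i = d := by
    rw [← Finsupp.degree_eq_sum, Finsupp.degree_eq_weight_one]
    exact hp (MvPolynomial.mem_support_iff.mp hs)
  have key := sum_antidiagonalTuple_prod_pow_mul_choose s mvec (hsf s hs) r (hsd.trans_le hdr)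
  rw [hsd, hmvec] at key
  simp only [div_pow, prod_div_distrib, prod_pow_eq_pow_sum, hsd]
  have hterm (α : Fin n → ℕ) :
      p.coeff s * ((∏ i, (α i : ℝ) ^ s i) / (r : ℝ) ^ d) *
          ((∏ i, ((mvec i).choose (α i) : ℝ)) / (m.choose r : ℝ)) =
        p.coeff s / ((r : ℝ) ^ d * (m.choose r : ℝ)) *
          ((∏ i, (α i : ℝ) ^ s i) * ∏ i, ((mvec i).choose (α i) : ℝ)) := by
    ring
  simp only [hterm]
  rw [← mul_sum, key]
  have pow_ne {k : ℕ} (hk : d ≤ k) : (k : ℝ) ^ d ≠ 0 := by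
    rcases Nat.eq_zero_or_pos k with rfl | hpos
    · simp [Nat.le_zero.mp hk]
    · positivity
  have hr := pow_ne hdr
  have hm := pow_ne (hdr.trans hrm)
  have hchoose : (m.choose r : ℝ) ≠ 0 := by exact_mod_cast (Nat.choose_pos hrm).ne'
  have hdesc : (m.descFactorial d : ℝ) ≠ 0 := by
    exact_mod_cast (Nat.descFactorial_pos.mpr (hdr.trans hrm)).ne'
  have hid : (m.choose r : ℝ) * r.descFactorial d =
      m.descFactorial d * (m - d).choose (r - d) := by
    exact_mod_cast Nat.choose_mul_descFactorial hdr
  field_simp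
  linear_combination (-(p.coeff s * ∏ i, (mvec i : ℝ) ^ s i)) * hid
end
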